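/- As holomorphic functions on ℍ×ℂ, 6·E_{6,2} = E_{6,1}φ_{0,1} − E₆φ_{0,2} = (1/24)(E₆φ_{0,1}² − 2E₄²φ_{0,1}φ_{−2,1} + E₄E₆φ_{−2,1}²). -/

import Mathlib

noncomputable section

open Complex

namespace JacobiPaper

/-- `e2 w = e^{2 π i w}`. -/
def e2 (w : ℂ) : ℂ := Complex.exp (2 * (Real.pi : ℂ) * Complex.I * w)

/-- `q = e^{2 π i τ}`. -/
def qC (τ : ℂ) : ℂ := e2 τ

/-- `ζ = e^{2 π i z}`. -/
def zetaC (z : ℂ) : ℂ := e2 z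

/-- The Dedekind eta function `η(τ) = q^{1/24} ∏_{n ≥ 1} (1 - qⁿ)`. -/
def eta (τ : ℂ) : ℂ :=
  Complex.exp ((Real.pi : ℂ) * Complex.I * τ / 12) * ∏' n : ℕ, (1 - qC τ ^ (n + 1))

/-- The odd Jacobi theta function
`ϑ(τ,z) = q^{1/8} (ζ^{1/2} - ζ^{-1/2}) ∏_{n ≥ 1} (1 - qⁿζ)(1 - qⁿζ⁻¹)(1 - qⁿ)`. -/
def theta (τ z : ℂ) : ℂ :=
  Complex.exp ((Real.pi : ℂ) * Complex.I * τ / 4) *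
    (Complex.exp ((Real.pi : ℂ) * Complex.I * z) - Complex.exp (-((Real.pi : ℂ) * Complex.I * z))) *
    ∏' n : ℕ,
      ((1 - qC τ ^ (n + 1) * zetaC z) * (1 - qC τ ^ (n + 1) * (zetaC z)⁻¹) * (1 - qC τ ^ (n + 1)))

/-- `ϑ₀₀(τ,z) = Σ_{n ∈ ℤ} q^{n²/2} ζⁿ`. -/
def theta00 (τ z : ℂ) : ℂ :=
  ∑' n : ℤ, Complex.exp ((Real.pi : ℂ) * Complex.I * (n : ℂ) ^ 2 * τ +
    2 * (Real.pi : ℂ) * Complex.I * (n : ℂ) * z)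

/-- `ϑ₀₁(τ,z) = Σ_{n ∈ ℤ} (-1)ⁿ q^{n²/2} ζⁿ`. -/
def theta01 (τ z : ℂ) : ℂ :=
  ∑' n : ℤ, (-1 : ℂ) ^ n * Complex.exp ((Real.pi : ℂ) * Complex.I * (n : ℂ) ^ 2 * τ +
    2 * (Real.pi : ℂ) * Complex.I * (n : ℂ) * z)

/-- `ϑ₁₀(τ,z) = q^{1/8} ζ^{1/2} Σ_{n ∈ ℤ} q^{n(n+1)/2} ζⁿ`. -/
def theta10 (τ z : ℂ) : ℂ :=
  Complex.exp ((Real.pi : ℂ) * Complex.I * τ / 4) * Complex.exp ((Real.pi : ℂ) * Complex.I * z) *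
    ∑' n : ℤ, Complex.exp ((Real.pi : ℂ) * Complex.I * (n : ℂ) * ((n : ℂ) + 1) * τ +
      2 * (Real.pi : ℂ) * Complex.I * (n : ℂ) * z)

/-- `ξ₀₀(τ,z) = ϑ₀₀(τ,z)/ϑ₀₀(τ,0)`. -/
def xi00 (τ z : ℂ) : ℂ := theta00 τ z / theta00 τ 0

/-- `ξ₀₁(τ,z) = ϑ₀₁(τ,z)/ϑ₀₁(τ,0)`. -/
def xi01 (τ z : ℂ) : ℂ := theta01 τ z / theta01 τ 0

/-- `ξ₁₀(τ,z) = ϑ₁₀(τ,z)/ϑ₁₀(τ,0)`. -/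
def xi10 (τ z : ℂ) : ℂ := theta10 τ z / theta10 τ 0

/-- The weak Jacobi form `φ_{0,1} = 4(ξ₀₀² + ξ₀₁² + ξ₁₀²)`. -/
def phi01 (τ z : ℂ) : ℂ := 4 * (xi00 τ z ^ 2 + xi01 τ z ^ 2 + xi10 τ z ^ 2)

/-- The weak Jacobi form `φ_{0,2}(τ,z) = 2(ξ₀₀ + ξ₀₁ + ξ₁₀)(τ,2z)`. -/
def phi02 (τ z : ℂ) : ℂ := 2 * (xi00 τ (2 * z) + xi01 τ (2 * z) + xi10 τ (2 * z))

/-- The weak Jacobi form `φ_{0,3}(τ,z) = ϑ(τ,2z)²/ϑ(τ,z)²`. -/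
def phi03 (τ z : ℂ) : ℂ := theta τ (2 * z) ^ 2 / theta τ z ^ 2

/-- The weak Jacobi form `φ_{0,4}(τ,z) = ϑ(τ,3z)/ϑ(τ,z)`. -/
def phi04 (τ z : ℂ) : ℂ := theta τ (3 * z) / theta τ z

/-- The weak Jacobi form `φ_{-2,1}(τ,z) = ϑ(τ,z)²/η(τ)⁶`. -/
def phiM21 (τ z : ℂ) : ℂ := theta τ z ^ 2 / eta τ ^ 6

/-- The divisor power sum `σ_k(n)`. -/
def sigma' (k n : ℕ) : ℕ := ∑ d ∈ n.divisors, d ^ k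

/-- The normalized Eisenstein series `E_k(τ) = 1 - (2k/B_k) Σ_{n ≥ 1} σ_{k-1}(n) qⁿ`. -/
def Eis (k : ℕ) (τ : ℂ) : ℂ :=
  1 - (2 * (k : ℂ) / ((bernoulli k : ℚ) : ℂ)) *
    ∑' n : ℕ, (sigma' (k - 1) (n + 1) : ℂ) * qC τ ^ (n + 1)

/-- The discriminant cusp form `Δ = η²⁴`. -/
def Delta (τ : ℂ) : ℂ := eta τ ^ 24

/-- The modular invariant `j = E₄³/Δ`. -/
def jInv (τ : ℂ) : ℂ := Eis 4 τ ^ 3 / Delta τ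

/-- A choice of `(a, b)` with `a d - b c = 1` completing a coprime pair `(c, d)` to a matrix
`(a b; c d) ∈ SL₂(ℤ)`. -/
def bezout (c d : ℤ) : ℤ × ℤ :=
  haveI : Decidable (∃ ab : ℤ × ℤ, ab.1 * d - ab.2 * c = 1) := Classical.propDecidable _
  if h : ∃ ab : ℤ × ℤ, ab.1 * d - ab.2 * c = 1 then h.choose else 0

/-- The summand `(cτ+d)^{-k} Σ_{l ∈ ℤ} e^{2πim(l²(aτ+b)/(cτ+d) + 2lz/(cτ+d) - cz²/(cτ+d))}`
of the Jacobi–Eisenstein series attached to a coprime pair `(c,d)`; it does not depend on the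
choice of `(a,b)` completing `(c,d)` to an element of `SL₂(ℤ)`. -/
def EisJSummand (k m : ℕ) (τ z : ℂ) (c d : ℤ) : ℂ :=
  ((c : ℂ) * τ + (d : ℂ)) ^ (-(k : ℤ)) *
    ∑' l : ℤ, e2 ((m : ℂ) * ((l : ℂ) ^ 2 * (((bezout c d).1 : ℂ) * τ + ((bezout c d).2 : ℂ)) /
        ((c : ℂ) * τ + (d : ℂ)) +
      2 * (l : ℂ) * z / ((c : ℂ) * τ + (d : ℂ)) - (c : ℂ) * z ^ 2 / ((c : ℂ) * τ + (d : ℂ))))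

/-- The Jacobi–Eisenstein series `E_{k,m}` of weight `k` and index `m`. -/
def EisJ (k m : ℕ) (τ z : ℂ) : ℂ :=
  (1 / 2) * ∑' p : {p : ℤ × ℤ // IsCoprime p.1 p.2}, EisJSummand k m τ z p.1.1 p.1.2

/-- `F_{6,3} = (1/2)(E_{6,1} φ_{0,2} - E₆ φ_{0,3})`. -/
def F63 (τ z : ℂ) : ℂ := (1 / 2) * (EisJ 6 1 τ z * phi02 τ z - Eis 6 τ * phi03 τ z)

/-- A weak Jacobi form of weight `k ∈ ℤ` and index `m ∈ ℕ`: a holomorphic function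
`φ : ℍ × ℂ → ℂ` satisfying the two Jacobi transformation laws and having a Fourier expansion
`φ(τ,z) = Σ_{n ≥ 0, l ∈ ℤ} f(n,l) qⁿ ζˡ`. -/
def IsWeakJacobiForm (k : ℤ) (m : ℕ) (φ : ℂ → ℂ → ℂ) (f : ℕ → ℤ → ℂ) : Prop :=
  DifferentiableOn ℂ (fun p : ℂ × ℂ => φ p.1 p.2) {p : ℂ × ℂ | 0 < p.1.im} ∧
  (∀ a b c d : ℤ, a * d - b * c = 1 → ∀ τ z : ℂ, 0 < τ.im →
    φ (((a : ℂ) * τ + (b : ℂ)) / ((c : ℂ) * τ + (d : ℂ))) (z / ((c : ℂ) * τ + (d : ℂ))) =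
      ((c : ℂ) * τ + (d : ℂ)) ^ k *
        e2 ((m : ℂ) * ((c : ℂ) * z ^ 2 / ((c : ℂ) * τ + (d : ℂ)))) * φ τ z) ∧
  (∀ x y : ℤ, ∀ τ z : ℂ, 0 < τ.im →
    φ τ (z + (x : ℂ) * τ + (y : ℂ)) =
      e2 (-(m : ℂ) * ((x : ℂ) ^ 2 * τ + 2 * (x : ℂ) * z)) * φ τ z) ∧
  (∀ τ z : ℂ, 0 < τ.im →
    HasSum (fun p : ℕ × ℤ => f p.1 p.2 * e2 ((p.1 : ℂ) * τ + (p.2 : ℂ) * z)) (φ τ z))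

/-- A weakly holomorphic Jacobi form of weight `0` and index `m ∈ ℕ`: as a weak Jacobi form,
but the Fourier expansion `φ(τ,z) = Σ_{n ≥ n₀, l ∈ ℤ} f(n,l) qⁿ ζˡ` may contain finitely many
negative powers of `q`. -/
def IsWeaklyHolomorphicJacobiForm0 (m : ℕ) (φ : ℂ → ℂ → ℂ) (f : ℤ → ℤ → ℂ) : Prop :=
  DifferentiableOn ℂ (fun p : ℂ × ℂ => φ p.1 p.2) {p : ℂ × ℂ | 0 < p.1.im} ∧
  (∀ a b c d : ℤ, a * d - b * c = 1 → ∀ τ z : ℂ, 0 < τ.im →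
    φ (((a : ℂ) * τ + (b : ℂ)) / ((c : ℂ) * τ + (d : ℂ))) (z / ((c : ℂ) * τ + (d : ℂ))) =
      e2 ((m : ℂ) * ((c : ℂ) * z ^ 2 / ((c : ℂ) * τ + (d : ℂ)))) * φ τ z) ∧
  (∀ x y : ℤ, ∀ τ z : ℂ, 0 < τ.im →
    φ τ (z + (x : ℂ) * τ + (y : ℂ)) =
      e2 (-(m : ℂ) * ((x : ℂ) ^ 2 * τ + 2 * (x : ℂ) * z)) * φ τ z) ∧
  (∃ n₀ : ℤ, ∀ n : ℤ, n < n₀ → ∀ l : ℤ, f n l = 0) ∧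
  (∀ τ z : ℂ, 0 < τ.im →
    HasSum (fun p : ℤ × ℤ => f p.1 p.2 * e2 ((p.1 : ℂ) * τ + (p.2 : ℂ) * z)) (φ τ z))

/-- A function `φ` on `ℍ × ℂ` has integral Fourier coefficients if it is the sum of a Fourier
series `Σ_{n ≥ 0, l ∈ ℤ} f(n,l) qⁿ ζˡ` with all `f(n,l) ∈ ℤ`. -/
def HasIntegralFourierExpansion (φ : ℂ → ℂ → ℂ) : Prop :=
  ∃ f : ℕ → ℤ → ℤ, ∀ τ z : ℂ, 0 < τ.im →
    HasSum (fun p : ℕ × ℤ => (f p.1 p.2 : ℂ) * e2 ((p.1 : ℂ) * τ + (p.2 : ℂ) * z)) (φ τ z)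

section LevelOneCuspForms

open UpperHalfPlane hiding I
open SlashInvariantForm MatrixGroups Filter
open scoped Topology ModularForm

/-- The filter `Im τ → ∞` on `ℂ`. -/
def imInf : Filter ℂ := comap Complex.im atTop

/-- A holomorphic function on the upper half-plane with the transformation behaviour of a level
one modular form of weight `k < 12` that vanishes at `i∞` is zero. -/
lemma eq_zero_of_weight_lt_twelve {k : ℤ} (hk : k < 12) {f : ℂ → ℂ}
    (hd : ∀ τ : ℂ, 0 < τ.im → DifferentiableAt ℂ f τ)
    (hT : ∀ τ : ℂ, 0 < τ.im → f (τ + 1) = f τ)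
    (hS : ∀ τ : ℂ, 0 < τ.im → f (-1 / τ) = τ ^ k * f τ)
    (hlim : Tendsto f imInf (𝓝 0)) {τ : ℂ} (hτ : 0 < τ.im) : f τ = 0 := by
  set F : ℍ → ℂ := fun τ => f τ with hF
  have hTi : F ∣[k] ModularGroup.T = F := by
    ext z
    rw [ModularForm.SL_slash_apply, modular_T_smul, ModularGroup.denom_apply]
    have := hT z z.2
    simp [hF, add_comm, this, ModularGroup.coe_T]
  have hSi : F ∣[k] ModularGroup.S = F := by
    ext z
    rw [ModularForm.SL_slash_apply, UpperHalfPlane.modular_S_smul]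
    have h0 : (z : ℂ) ≠ 0 := UpperHalfPlane.ne_zero z
    have := hS z z.2
    have h2 : (-(z : ℂ))⁻¹ = -1 / z := by rw [neg_div, inv_neg, one_div]
    simp only [hF]
    rw [h2, this, ModularGroup.denom_apply]
    simp [ModularGroup.coe_S]
    field_simp
  have hz : IsZeroAtImInfty F := by
    have : Tendsto (fun z : ℍ => (z : ℂ)) atImInfty imInf := by
      rw [imInf, tendsto_comap_iff]
      exact tendsto_comap
    exact hlim.comp this
  let G : CuspForm 𝒮ℒ k :=
    { toFun := F
      slash_action_eq' := by
        rintro A ⟨A, rfl⟩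
        exact slash_action_generators_SL2Z hSi hTi A
      holo' := by
        rw [UpperHalfPlane.mdifferentiable_iff]
        refine .congr (fun z hz ↦ (hd z hz).differentiableWithinAt) fun z hz ↦ ?_
        simp [hF, ofComplex_apply_of_im_pos hz]
      zero_at_cusps' := by
        intro c hc
        rw [Subgroup.IsArithmetic.isCusp_iff_isCusp_SL2Z] at hc
        rw [OnePoint.isZeroAt_iff_forall_SL2Z hc]
        intro γ _
        rw [slash_action_generators_SL2Z hSi hTi]
        exact hz }
  have h0 : G = 0 := rank_zero_iff_forall_zero.mp (CuspForm.rank_eq_zero_of_weight_lt_twelve hk) G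
  have : G ⟨τ, hτ⟩ = 0 := by rw [h0]; rfl
  exact this

end LevelOneCuspForms

section TaylorCoefficients

open Filter Metric
open scoped Topology

lemma isOpen_im_pos : IsOpen {τ : ℂ | 0 < τ.im} := isOpen_lt continuous_const Complex.continuous_im

lemma im_neg_one_div_pos {τ : ℂ} (hτ : 0 < τ.im) : 0 < (-1 / τ).im := by
  rw [neg_div, one_div, ← inv_neg]
  exact UpperHalfPlane.im_inv_neg_coe_pos ⟨τ, hτ⟩

lemma ne_zero_of_im_pos {τ : ℂ} (hτ : 0 < τ.im) : τ ≠ 0 := by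
  rintro rfl
  simp at hτ

lemma eventually_imInf_gt (A : ℝ) : ∀ᶠ τ in imInf, A < τ.im :=
  (eventually_gt_atTop A).comap _

/-- A family of entire functions `G τ`, holomorphic in `τ` in the upper half-plane and locally
bounded there, which tends to zero at `i∞` uniformly on the closed unit disc. -/
structure TameFamily (G : ℂ → ℂ → ℂ) : Prop where
  differentiable : ∀ τ : ℂ, 0 < τ.im → Differentiable ℂ (G τ)
  differentiableAt : ∀ τ z : ℂ, 0 < τ.im → DifferentiableAt ℂ (fun t => G t z) τ
  bounded : ∀ τ : ℂ, 0 < τ.im → ∃ M : ℝ, ∀ᶠ t in 𝓝 τ, ∀ z ∈ closedBall (0 : ℂ) 1, ‖G t z‖ ≤ M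
  tendsto : ∀ ε : ℝ, 0 < ε → ∀ᶠ t in imInf, ∀ z ∈ closedBall (0 : ℂ) 1, ‖G t z‖ ≤ ε

lemma TameFamily.of_tendsto {φ : ℂ → ℂ → ℂ}
    (hc : ∀ τ z : ℂ, 0 < τ.im → ContinuousAt (fun p : ℂ × ℂ => φ p.1 p.2) (τ, z))
    (h1 : ∀ τ z : ℂ, 0 < τ.im → DifferentiableAt ℂ (fun t => φ t z) τ)
    (h2 : ∀ τ z : ℂ, 0 < τ.im → DifferentiableAt ℂ (φ τ) z)
    (hlim : ∀ z : ℂ, Tendsto (fun p : ℂ × ℂ => φ p.1 p.2) (imInf ×ˢ 𝓝 z) (𝓝 0)) :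
    TameFamily φ where
  differentiable τ hτ z := h2 τ z hτ
  differentiableAt := h1
  bounded τ hτ := by
    have hc' : ContinuousOn (φ τ) (closedBall 0 1) := fun z _ =>
      (h2 τ z hτ).continuousAt.continuousWithinAt
    obtain ⟨M, hM⟩ := (isCompact_closedBall (0 : ℂ) 1).exists_bound_of_continuousOn hc'
    refine ⟨M + 1, (isCompact_closedBall (0 : ℂ) 1).eventually_forall_of_forall_eventually
      (P := fun t z => ‖φ t z‖ ≤ M + 1) fun z hz => ?_⟩
    have := (hc τ z hτ).norm.tendsto.eventually_lt_const ((hM z hz).trans_lt (lt_add_one M))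
    exact this.mono fun p hp => hp.le
  tendsto ε hε := by
    have := (isCompact_closedBall (0 : ℂ) 1).mem_prod_nhdsSet_of_forall (l := imInf)
      (s := {p : ℂ × ℂ | ‖φ p.1 p.2‖ ≤ ε}) fun z hz => by
        have h1 := (hlim z).norm
        rw [norm_zero] at h1
        exact (h1.eventually (gt_mem_nhds hε)).mono fun p hp => hp.le
    obtain ⟨u, hu, v, hv, huv⟩ := mem_prod_iff.1 this
    filter_upwards [hu] with t ht z hz
    exact huv (Set.mk_mem_prod ht (subset_of_mem_nhdsSet hv hz))

lemma norm_dslope_le {g : ℂ → ℂ} (hg : Differentiable ℂ g) (h0 : g 0 = 0) {M : ℝ}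
    (hM : ∀ z ∈ closedBall (0 : ℂ) 1, ‖g z‖ ≤ M) :
    ∀ z ∈ closedBall (0 : ℂ) 1, ‖dslope g 0 z‖ ≤ M := by
  have hd : Differentiable ℂ (dslope g 0) := by
    rw [← differentiableOn_univ] at hg ⊢
    exact (Complex.differentiableOn_dslope univ_mem).2 hg
  intro z hz
  refine Complex.norm_le_of_forall_mem_frontier_norm_le (U := ball (0 : ℂ) 1) isBounded_ball
    hd.diffContOnCl (fun w hw => ?_) (by rwa [closure_ball _ one_ne_zero])
  rw [frontier_ball _ one_ne_zero] at hw
  have hw1 : ‖w‖ = 1 := by simpa using hw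
  have hw0 : w ≠ 0 := by
    rintro rfl
    simp at hw1
  rw [dslope_of_ne _ hw0, slope_def_field, h0]
  simpa [hw1] using hM w (by simp [hw1])

lemma TameFamily.dslope {G : ℂ → ℂ → ℂ} (hG : TameFamily G)
    (h0 : ∀ τ : ℂ, 0 < τ.im → G τ 0 = 0) : TameFamily (fun τ => dslope (G τ) 0) := by
  have hd : ∀ τ : ℂ, 0 < τ.im → Differentiable ℂ (_root_.dslope (G τ) 0) := by
    intro τ hτ
    have := hG.differentiable τ hτ
    rw [← differentiableOn_univ] at this ⊢
    exact (Complex.differentiableOn_dslope univ_mem).2 this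
  have hne : ∀ τ z : ℂ, 0 < τ.im → z ≠ 0 →
      DifferentiableAt ℂ (fun t => _root_.dslope (G t) 0 z) τ := by
    intro τ z hτ hz
    have : (fun t => _root_.dslope (G t) 0 z) = fun t => (G t z - G t 0) / (z - 0) := by
      ext t
      rw [dslope_of_ne _ hz, slope_def_field]
    rw [this]
    exact ((hG.differentiableAt τ z hτ).sub (hG.differentiableAt τ 0 hτ)).div_const _
  have hb : ∀ τ : ℂ, 0 < τ.im → ∃ M : ℝ, ∀ᶠ t in 𝓝 τ, ∀ z ∈ closedBall (0 : ℂ) 1,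
      ‖_root_.dslope (G t) 0 z‖ ≤ M := by
    intro τ hτ
    obtain ⟨M, hM⟩ := hG.bounded τ hτ
    refine ⟨M, ?_⟩
    filter_upwards [hM, isOpen_im_pos.mem_nhds hτ] with t ht ht'
    exact norm_dslope_le (hG.differentiable t ht') (h0 t ht') ht
  refine ⟨hd, fun τ z hτ => ?_, hb, fun ε hε => ?_⟩
  · rcases ne_or_eq z 0 with hz | rfl
    · exact hne τ z hτ hz
    have hlim : TendstoLocallyUniformlyOn (fun (z t : ℂ) => _root_.dslope (G t) 0 z)
        (fun t => _root_.dslope (G t) 0 0) (𝓝[≠] 0) {t : ℂ | 0 < t.im} := by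
      rw [Metric.tendstoLocallyUniformlyOn_iff]
      intro ε hε τ hτ
      obtain ⟨M, hM⟩ := hb τ hτ
      refine ⟨_, mem_nhdsWithin_of_mem_nhds (inter_mem hM (isOpen_im_pos.mem_nhds hτ)), ?_⟩
      have h1 : ∀ᶠ z : ℂ in 𝓝[≠] 0, ‖z‖ < 1 ∧ 2 * M * ‖z‖ < ε := by
        refine nhdsWithin_le_nhds (((continuous_norm.tendsto' (0 : ℂ) 0 (by simp)).eventually
          (gt_mem_nhds one_pos)).and ?_)
        have : Tendsto (fun z : ℂ => 2 * M * ‖z‖) (𝓝 0) (𝓝 0) :=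
          Continuous.tendsto' (by fun_prop) _ _ (by simp)
        exact this.eventually (gt_mem_nhds hε)
      filter_upwards [h1] with z hz t ht
      have key := Complex.dist_le_div_mul_dist_of_mapsTo_ball (R₁ := 1) (R₂ := 2 * M) (c := 0)
        (z := z) (hd t ht.2).differentiableOn (fun w hw => by
          have h1 := ht.1 w (ball_subset_closedBall hw)
          have h2 := ht.1 0 (by simp)
          rw [mem_closedBall, dist_eq_norm]
          exact (norm_sub_le _ _).trans (by linarith)) (by simpa using hz.1)
      rw [dist_comm]
      refine key.trans_lt ?_
      simpa using hz.2
    exact (hlim.differentiableOn (by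
      filter_upwards [self_mem_nhdsWithin] with z hz
      exact fun τ hτ => (hne τ z hτ hz).differentiableWithinAt) isOpen_im_pos).differentiableAt
      (isOpen_im_pos.mem_nhds hτ)
  · filter_upwards [hG.tendsto ε hε, eventually_imInf_gt 0] with t ht ht'
    exact norm_dslope_le (hG.differentiable t ht') (h0 t ht') ht

end TaylorCoefficients

section JacobiLike

open Filter Metric
open scoped Topology

lemma e2_add (x y : ℂ) : e2 (x + y) = e2 x * e2 y := by
  simp only [e2, mul_add, Complex.exp_add]

lemma e2_ne_zero (x : ℂ) : e2 x ≠ 0 := Complex.exp_ne_zero _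

lemma e2_zero : e2 0 = 1 := by simp [e2]

lemma e2_neg (x : ℂ) : e2 (-x) = (e2 x)⁻¹ := by
  rw [e2, e2, ← Complex.exp_neg]
  ring_nf

lemma e2_int (n : ℤ) : e2 n = 1 := by
  rw [e2, ← Complex.exp_int_mul_two_pi_mul_I n]
  ring_nf

lemma e2_one : e2 1 = 1 := by simpa using e2_int 1

lemma e2_nat_mul (n : ℕ) (x : ℂ) : e2 (n * x) = e2 x ^ n := by
  rw [e2, e2, ← Complex.exp_nat_mul]
  ring_nf

lemma norm_e2 (x : ℂ) : ‖e2 x‖ = Real.exp (-(2 * Real.pi * x.im)) := by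
  rw [e2, Complex.norm_exp]
  simp

lemma continuous_e2 : Continuous e2 := by
  unfold e2
  fun_prop

lemma differentiable_e2 : Differentiable ℂ e2 := by
  unfold e2
  fun_prop

/-- Functions on `ℍ × ℂ` with the properties of a weak Jacobi form of weight `k` and index `m`,
with constant term `g z` of the Fourier expansion. -/
structure JacobiLike (k m : ℤ) (φ : ℂ → ℂ → ℂ) (g : ℂ → ℂ) : Prop where
  continuousAt : ∀ τ z : ℂ, 0 < τ.im → ContinuousAt (fun p : ℂ × ℂ => φ p.1 p.2) (τ, z)
  differentiableAt_fst : ∀ τ z : ℂ, 0 < τ.im → DifferentiableAt ℂ (fun t => φ t z) τ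
  differentiableAt_snd : ∀ τ z : ℂ, 0 < τ.im → DifferentiableAt ℂ (φ τ) z
  add_one : ∀ τ z : ℂ, 0 < τ.im → φ (τ + 1) z = φ τ z
  inv : ∀ τ z : ℂ, 0 < τ.im → φ (-1 / τ) (z / τ) = τ ^ k * e2 (m * z ^ 2 / τ) * φ τ z
  add_one_right : ∀ τ z : ℂ, 0 < τ.im → φ τ (z + 1) = φ τ z
  add_tau_right : ∀ τ z : ℂ, 0 < τ.im → φ τ (z + τ) = e2 (-m * (τ + 2 * z)) * φ τ z
  tendsto : ∀ z : ℂ, Tendsto (fun p : ℂ × ℂ => φ p.1 p.2) (imInf ×ˢ 𝓝 z) (𝓝 (g z))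

namespace JacobiLike

variable {k k' m m' : ℤ} {φ ψ : ℂ → ℂ → ℂ} {g h : ℂ → ℂ}

lemma mul (hφ : JacobiLike k m φ g) (hψ : JacobiLike k' m' ψ h) :
    JacobiLike (k + k') (m + m') (fun τ z => φ τ z * ψ τ z) (fun z => g z * h z) where
  continuousAt τ z hτ := (hφ.continuousAt τ z hτ).mul (hψ.continuousAt τ z hτ)
  differentiableAt_fst τ z hτ :=
    (hφ.differentiableAt_fst τ z hτ).mul (hψ.differentiableAt_fst τ z hτ)
  differentiableAt_snd τ z hτ :=
    (hφ.differentiableAt_snd τ z hτ).mul (hψ.differentiableAt_snd τ z hτ)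
  add_one τ z hτ := by rw [hφ.add_one τ z hτ, hψ.add_one τ z hτ]
  inv τ z hτ := by
    have h0 : τ ≠ 0 := ne_zero_of_im_pos hτ
    rw [hφ.inv τ z hτ, hψ.inv τ z hτ, zpow_add₀ h0]
    have : ((m + m' : ℤ) : ℂ) * z ^ 2 / τ = m * z ^ 2 / τ + m' * z ^ 2 / τ := by
      push_cast
      ring
    rw [this, e2_add]
    ring
  add_one_right τ z hτ := by rw [hφ.add_one_right τ z hτ, hψ.add_one_right τ z hτ]
  add_tau_right τ z hτ := by
    rw [hφ.add_tau_right τ z hτ, hψ.add_tau_right τ z hτ]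
    have : -((m + m' : ℤ) : ℂ) * (τ + 2 * z) = -m * (τ + 2 * z) + -m' * (τ + 2 * z) := by
      push_cast
      ring
    rw [this, e2_add]
    ring
  tendsto z := (hφ.tendsto z).mul (hψ.tendsto z)

lemma add (hφ : JacobiLike k m φ g) (hψ : JacobiLike k m ψ h) :
    JacobiLike k m (fun τ z => φ τ z + ψ τ z) (fun z => g z + h z) where
  continuousAt τ z hτ := (hφ.continuousAt τ z hτ).add (hψ.continuousAt τ z hτ)
  differentiableAt_fst τ z hτ :=
    (hφ.differentiableAt_fst τ z hτ).add (hψ.differentiableAt_fst τ z hτ)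
  differentiableAt_snd τ z hτ :=
    (hφ.differentiableAt_snd τ z hτ).add (hψ.differentiableAt_snd τ z hτ)
  add_one τ z hτ := by rw [hφ.add_one τ z hτ, hψ.add_one τ z hτ]
  inv τ z hτ := by
    rw [hφ.inv τ z hτ, hψ.inv τ z hτ]
    ring
  add_one_right τ z hτ := by rw [hφ.add_one_right τ z hτ, hψ.add_one_right τ z hτ]
  add_tau_right τ z hτ := by
    rw [hφ.add_tau_right τ z hτ, hψ.add_tau_right τ z hτ]
    ring
  tendsto z := (hφ.tendsto z).add (hψ.tendsto z)

lemma const_mul (c : ℂ) (hφ : JacobiLike k m φ g) :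
    JacobiLike k m (fun τ z => c * φ τ z) (fun z => c * g z) where
  continuousAt τ z hτ := (hφ.continuousAt τ z hτ).const_mul c
  differentiableAt_fst τ z hτ := (hφ.differentiableAt_fst τ z hτ).const_mul c
  differentiableAt_snd τ z hτ := (hφ.differentiableAt_snd τ z hτ).const_mul c
  add_one τ z hτ := by rw [hφ.add_one τ z hτ]
  inv τ z hτ := by
    rw [hφ.inv τ z hτ]
    ring
  add_one_right τ z hτ := by rw [hφ.add_one_right τ z hτ]
  add_tau_right τ z hτ := by
    rw [hφ.add_tau_right τ z hτ]
    ring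
  tendsto z := (hφ.tendsto z).const_mul c

lemma tameFamily (hφ : JacobiLike k m φ g) (hg : ∀ z, g z = 0) : TameFamily φ :=
  .of_tendsto hφ.continuousAt hφ.differentiableAt_fst hφ.differentiableAt_snd fun z =>
    hg z ▸ hφ.tendsto z

/-- Being a weak Jacobi form only depends on the values on `ℍ × ℂ`. -/
lemma congr (hφ : JacobiLike k m φ g) (h : ∀ τ z : ℂ, 0 < τ.im → ψ τ z = φ τ z) :
    JacobiLike k m ψ g where
  continuousAt τ z hτ := by
    refine (hφ.continuousAt τ z hτ).congr ?_
    have : ∀ᶠ p : ℂ × ℂ in 𝓝 (τ, z), 0 < p.1.im :=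
      (isOpen_im_pos.preimage continuous_fst).mem_nhds hτ
    filter_upwards [this] with p hp
    exact (h _ _ hp).symm
  differentiableAt_fst τ z hτ := by
    refine (hφ.differentiableAt_fst τ z hτ).congr_of_eventuallyEq ?_
    filter_upwards [isOpen_im_pos.mem_nhds hτ] with t ht
    exact h _ _ ht
  differentiableAt_snd τ z hτ := by
    rw [show ψ τ = φ τ from funext fun w => h τ w hτ]
    exact hφ.differentiableAt_snd τ z hτ
  add_one τ z hτ := by
    rw [h _ _ hτ, h (τ + 1) z (by simpa using hτ), hφ.add_one τ z hτ]
  inv τ z hτ := by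
    rw [h _ _ hτ, h _ _ (im_neg_one_div_pos hτ), hφ.inv τ z hτ]
  add_one_right τ z hτ := by rw [h _ _ hτ, h _ _ hτ, hφ.add_one_right τ z hτ]
  add_tau_right τ z hτ := by rw [h _ _ hτ, h _ _ hτ, hφ.add_tau_right τ z hτ]
  tendsto z := by
    refine (hφ.tendsto z).congr' ?_
    filter_upwards [tendsto_fst.eventually (eventually_imInf_gt 0)] with p hp
    exact (h _ _ hp).symm

end JacobiLike

/-- A weak Jacobi form of weight `k` with vanishing constant term vanishes to order `12 - k`
at `z = 0`. -/
lemma JacobiLike.exists_eq_pow_mul {k m : ℤ} {φ : ℂ → ℂ → ℂ} {g : ℂ → ℂ}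
    (hφ : JacobiLike k m φ g) (hg : ∀ z, g z = 0) (n : ℕ) (hn : k + n ≤ 12) :
    ∃ G : ℂ → ℂ → ℂ, TameFamily G ∧ ∀ τ z : ℂ, 0 < τ.im → φ τ z = z ^ n * G τ z := by
  induction n with
  | zero => exact ⟨φ, hφ.tameFamily hg, fun τ z _ => by simp⟩
  | succ n ih =>
    obtain ⟨G, hG, hφG⟩ := ih (by push_cast at hn; lia)
    have hcont : ∀ τ : ℂ, 0 < τ.im → Tendsto (G τ) (𝓝[≠] 0) (𝓝 (G τ 0)) := fun τ hτ =>
      ((hG.differentiable τ hτ).continuous.tendsto 0).mono_left nhdsWithin_le_nhds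
    have h0 : ∀ τ : ℂ, 0 < τ.im → G τ 0 = 0 := by
      intro τ hτ
      refine eq_zero_of_weight_lt_twelve (k := k + n) (f := fun τ => G τ 0)
        (by push_cast at hn; lia)
        (fun τ hτ => hG.differentiableAt τ 0 hτ) (fun τ hτ => ?_) (fun τ hτ => ?_) ?_ hτ
      · have h1 : 0 < (τ + 1).im := by simpa using hτ
        refine tendsto_nhds_unique (hcont _ h1) ((hcont τ hτ).congr' ?_)
        filter_upwards [self_mem_nhdsWithin] with z hz
        have := hφ.add_one τ z hτ
        rw [hφG _ _ h1, hφG _ _ hτ] at this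
        exact (mul_left_cancel₀ (pow_ne_zero n hz) this).symm
      · have ht0 : τ ≠ 0 := ne_zero_of_im_pos hτ
        have h1 := im_neg_one_div_pos hτ
        have hdiv : Tendsto (fun z : ℂ => z / τ) (𝓝[≠] 0) (𝓝[≠] 0) := by
          refine tendsto_nhdsWithin_iff.2 ⟨?_, ?_⟩
          · exact (Continuous.tendsto' (by fun_prop) _ _ (by simp)).mono_left nhdsWithin_le_nhds
          · filter_upwards [self_mem_nhdsWithin] with z hz
            exact div_ne_zero hz ht0
        have hlim : Tendsto (fun z => τ ^ (k + n) * e2 (m * z ^ 2 / τ) * G τ z) (𝓝[≠] 0)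
            (𝓝 (τ ^ (k + n) * 1 * G τ 0)) := by
          refine (Tendsto.const_mul _ ?_).mul (hcont τ hτ)
          refine (Continuous.tendsto' ?_ _ _ (by simp [e2_zero])).mono_left nhdsWithin_le_nhds
          exact continuous_e2.comp (by fun_prop)
        rw [mul_one] at hlim
        refine tendsto_nhds_unique ((hcont _ h1).comp hdiv) (hlim.congr' ?_)
        filter_upwards [self_mem_nhdsWithin] with z hz
        have hz' : z ≠ 0 := hz
        have := hφ.inv τ z hτ
        rw [hφG _ _ h1, hφG _ _ hτ] at this
        have h2 : (z / τ) ^ n ≠ 0 := pow_ne_zero n (div_ne_zero hz ht0)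
        refine mul_left_cancel₀ h2 ?_
        rw [Function.comp_apply, this, div_pow, zpow_add₀ ht0, zpow_natCast]
        field_simp
      · rw [Metric.tendsto_nhds]
        intro ε hε
        filter_upwards [hG.tendsto (ε / 2) (by positivity)] with t ht
        have := ht 0 (by simp)
        simp only [dist_zero_right]
        linarith
    refine ⟨_, hG.dslope h0, fun τ z hτ => ?_⟩
    have := sub_smul_dslope (G τ) 0 z
    rw [h0 τ hτ] at this
    simp only [sub_zero, smul_eq_mul] at this
    rw [hφG τ z hτ, ← this, pow_succ, mul_assoc]

end JacobiLike

section Liouville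

open Filter Metric
open scoped Topology

/-- Reduction of a complex number modulo the lattice `ℤτ + ℤ`. -/
lemma exists_sub_lattice_norm_le {τ : ℂ} (hτ : 0 < τ.im) (z : ℂ) :
    ∃ x y : ℤ, ‖z - (x * τ + y)‖ ≤ ‖τ‖ + 1 := by
  set p : ℝ := z.im / τ.im with hp
  set r : ℝ := z.re - p * τ.re with hr
  have hz : z = p * τ + r := by
    apply Complex.ext
    · simp [hr]
    · simp [hp]
      field_simp
  refine ⟨⌊p⌋, ⌊r⌋, ?_⟩
  have : z - (⌊p⌋ * τ + ⌊r⌋) = (Int.fract p : ℝ) * τ + (Int.fract r : ℝ) := by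
    rw [hz, Int.fract, Int.fract]
    push_cast
    ring
  rw [this]
  refine (norm_add_le _ _).trans ?_
  rw [norm_mul, Complex.norm_real, Complex.norm_real, Real.norm_of_nonneg (Int.fract_nonneg _),
    Real.norm_of_nonneg (Int.fract_nonneg _)]
  exact add_le_add (mul_le_of_le_one_left (norm_nonneg _) (Int.fract_lt_one _).le)
    (Int.fract_lt_one _).le

/-- Two entire functions with the same quasi-periods: if `θ` only vanishes at lattice points and
`f / θ` tends to zero at the origin, then `f` vanishes. -/
lemma eq_zero_of_quasiperiodic {τ : ℂ} (hτ : 0 < τ.im) {f θ a b : ℂ → ℂ}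
    (hf : Differentiable ℂ f) (hθ : Differentiable ℂ θ) (ha : ∀ z, a z ≠ 0) (hb : ∀ z, b z ≠ 0)
    (hf1 : ∀ z, f (z + 1) = a z * f z) (hθ1 : ∀ z, θ (z + 1) = a z * θ z)
    (hfτ : ∀ z, f (z + τ) = b z * f z) (hθτ : ∀ z, θ (z + τ) = b z * θ z)
    (hzero : ∀ z, θ z = 0 → ∃ x y : ℤ, z = x * τ + y) (h0 : θ 0 = 0)
    (hne : ∀ᶠ z in 𝓝[≠] 0, θ z ≠ 0) (hlim : Tendsto (fun z => f z / θ z) (𝓝[≠] 0) (𝓝 0)) (z : ℂ) :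
    f z = 0 := by
  set Q : ℂ → ℂ := fun z => f z / θ z with hQ
  have hQ1 : Function.Periodic Q 1 := fun z => by
    simp only [hQ, hf1, hθ1, mul_div_mul_left _ _ (ha z)]
  have hQτ : Function.Periodic Q τ := fun z => by
    simp only [hQ, hfτ, hθτ, mul_div_mul_left _ _ (hb z)]
  have hper : ∀ (x y : ℤ), Function.Periodic Q (x * τ + y) := fun x y => by
    have := (hQτ.int_mul x).add_period (hQ1.int_mul y)
    simpa using this
  have hQ0 : Q 0 = 0 := by simp [hQ, h0]
  have hd0 : DifferentiableAt ℂ Q 0 := by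
    set s : Set ℂ := {z | z ≠ 0 → θ z ≠ 0} with hs
    have hmem : s ∈ 𝓝 (0 : ℂ) := by
      rw [eventually_nhdsWithin_iff] at hne
      exact hne
    refine (Complex.differentiableOn_compl_singleton_and_continuousAt_iff hmem).1
      ⟨fun z hz => ?_, ?_⟩ |>.differentiableAt hmem
    · exact ((hf z).div (hθ z) (hz.1 hz.2)).differentiableWithinAt
    · refine continuousAt_of_tendsto_nhds (y := 0) ?_
      have : Tendsto Q (𝓝[≠] 0 ⊔ pure 0) (𝓝 0) := tendsto_sup.2
        ⟨hlim, by rw [tendsto_pure_left, hQ0]; exact fun s hs => mem_of_mem_nhds hs⟩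
      rwa [nhdsNE_sup_pure] at this
  have hd : Differentiable ℂ Q := by
    intro z
    by_cases hz : θ z = 0
    · obtain ⟨x, y, rfl⟩ := hzero z hz
      have : Q = fun w => Q (w - (x * τ + y)) := by
        ext w
        exact ((hper x y).sub_eq w).symm
      rw [this]
      refine DifferentiableAt.comp (g := Q) _ ?_ (by fun_prop)
      simpa using hd0
    · exact (hf z).div (hθ z) hz
  have hbdd : Bornology.IsBounded (Set.range Q) := by
    refine ((isCompact_closedBall (0 : ℂ) (‖τ‖ + 1)).image hd.continuous).isBounded.subset ?_
    rintro _ ⟨w, rfl⟩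
    obtain ⟨x, y, h⟩ := exists_sub_lattice_norm_le hτ w
    exact ⟨w - (x * τ + y), by simpa using h, (hper x y).sub_eq w⟩
  have hQz : ∀ w, Q w = 0 := fun w => by
    rw [hd.apply_eq_apply_of_bounded hbdd w 0, hQ0]
  have hfr : ∃ᶠ w in 𝓝[≠] (0 : ℂ), f w = 0 :=
    (hne.mono fun w hw => by simpa [hQ, hw] using hQz w).frequently
  exact (hf.differentiableOn.analyticOnNhd isOpen_univ).eqOn_zero_of_preconnected_of_frequently_eq_zero
    isPreconnected_univ (Set.mem_univ 0) hfr (Set.mem_univ z)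

end Liouville

section ThetaProduct

open Filter Metric
open scoped Topology

lemma norm_qC_lt_one {τ : ℂ} (hτ : 0 < τ.im) : ‖qC τ‖ < 1 := by
  rw [qC, norm_e2, Real.exp_lt_one_iff]
  have := Real.pi_pos
  nlinarith [mul_pos this hτ]

/-- The product `∏_{n ≥ 1} (1 - qⁿ x)`. -/
def qProd (q x : ℂ) : ℂ := ∏' n : ℕ, (1 - q ^ (n + 1) * x)

lemma summable_qProd {q : ℂ} (hq : ‖q‖ < 1) (x : ℂ) :
    Summable fun n : ℕ => ‖-(q ^ (n + 1) * x)‖ := by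
  simp only [norm_neg, norm_mul, norm_pow]
  exact ((summable_nat_add_iff 1).mpr
    (summable_geometric_of_lt_one (norm_nonneg _) hq)).mul_right _

lemma multipliable_qProd {q : ℂ} (hq : ‖q‖ < 1) (x : ℂ) :
    Multipliable fun n : ℕ => 1 - q ^ (n + 1) * x := by
  simp only [sub_eq_add_neg]
  exact multipliable_one_add_of_summable (summable_qProd hq x)

lemma qProd_ne_zero {q x : ℂ} (hq : ‖q‖ < 1) (h : ∀ n : ℕ, q ^ (n + 1) * x ≠ 1) :
    qProd q x ≠ 0 := by
  simp only [qProd, sub_eq_add_neg]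
  refine tprod_one_add_ne_zero_of_summable (fun n hn => h n ?_) (summable_qProd hq x)
  rw [← sub_eq_add_neg, sub_eq_zero] at hn
  exact hn.symm

lemma qProd_eq_mul {q : ℂ} (hq : ‖q‖ < 1) (x : ℂ) :
    qProd q x = (1 - q * x) * qProd q (q * x) := by
  have h := multipliable_qProd hq (q * x)
  have h2 : (fun n : ℕ => 1 - q ^ (n + 1) * (q * x)) = fun n : ℕ => 1 - q ^ (n + 1 + 1) * x := by
    ext n
    ring
  rw [h2] at h
  rw [qProd, qProd, h2, tprod_eq_zero_mul' (f := fun n : ℕ => 1 - q ^ (n + 1) * x) h]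
  simp

lemma differentiable_qProd {q : ℂ} (hq : ‖q‖ < 1) : Differentiable ℂ (qProd q) := by
  intro x
  have h := Summable.hasProdLocallyUniformlyOn_nat_one_add (K := ball (0 : ℂ) (‖x‖ + 1))
    (f := fun n x => -(q ^ (n + 1) * x)) isOpen_ball (u := fun n => ‖q‖ ^ (n + 1) * (‖x‖ + 1))
    (((summable_nat_add_iff 1).mpr
      (summable_geometric_of_lt_one (norm_nonneg _) hq)).mul_right _)
    (.of_forall fun n y hy => by
      rw [norm_neg, norm_mul, norm_pow]
      have : ‖y‖ ≤ ‖x‖ + 1 := by simpa using (mem_ball_zero_iff.1 hy).le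
      gcongr) (fun n => by fun_prop)
  have h2 := h.differentiableOn (.of_forall fun s => by
    simpa [Finset.prod_fn] using DifferentiableOn.finsetProd (fun _ _ ↦ by fun_prop)) isOpen_ball
  simp only [← sub_eq_add_neg] at h2
  exact h2.differentiableAt (isOpen_ball.mem_nhds (by simp))

lemma theta_eq {τ : ℂ} (hτ : 0 < τ.im) (z : ℂ) :
    theta τ z = Complex.exp ((Real.pi : ℂ) * Complex.I * τ / 4) *
      (Complex.exp ((Real.pi : ℂ) * Complex.I * z) - Complex.exp (-((Real.pi : ℂ) * Complex.I * z))) *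
      (qProd (qC τ) (zetaC z) * qProd (qC τ) (zetaC z)⁻¹ * qProd (qC τ) 1) := by
  have hq := norm_qC_lt_one hτ
  have h1 := multipliable_qProd hq (zetaC z)
  have h2 := multipliable_qProd hq (zetaC z)⁻¹
  have h3 := multipliable_qProd hq 1
  rw [theta, qProd, qProd, qProd, ← h1.tprod_mul h2, ← (h1.mul h2).tprod_mul h3]
  simp

lemma theta_zero (τ : ℂ) : theta τ 0 = 0 := by simp [theta]

lemma differentiable_theta {τ : ℂ} (hτ : 0 < τ.im) : Differentiable ℂ (theta τ) := by
  have hq := norm_qC_lt_one hτ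
  have h : theta τ = fun z => _ := funext (theta_eq hτ)
  rw [h]
  have h1 : Differentiable ℂ (fun z => qProd (qC τ) (zetaC z)) :=
    (differentiable_qProd hq).comp differentiable_e2
  have h2 : Differentiable ℂ (fun z => qProd (qC τ) (zetaC z)⁻¹) :=
    (differentiable_qProd hq).comp (differentiable_e2.inv e2_ne_zero)
  fun_prop

lemma theta_add_one {τ : ℂ} (hτ : 0 < τ.im) (z : ℂ) : theta τ (z + 1) = -1 * theta τ z := by
  have h : zetaC (z + 1) = zetaC z := by rw [zetaC, e2_add, e2_one, mul_one, zetaC]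
  rw [theta_eq hτ, theta_eq hτ, h]
  have h2 : Complex.exp ((Real.pi : ℂ) * Complex.I * (z + 1)) =
      -Complex.exp ((Real.pi : ℂ) * Complex.I * z) := by
    rw [mul_add, Complex.exp_add, mul_one, Complex.exp_pi_mul_I]
    ring
  rw [Complex.exp_neg, h2, Complex.exp_neg, inv_neg]
  ring

lemma theta_add_tau {τ : ℂ} (hτ : 0 < τ.im) (z : ℂ) :
    theta τ (z + τ) = -Complex.exp (-((Real.pi : ℂ) * Complex.I * (τ + 2 * z))) * theta τ z := by
  have hq := norm_qC_lt_one hτ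
  set s := Complex.exp ((Real.pi : ℂ) * Complex.I * z) with hs
  set p := Complex.exp ((Real.pi : ℂ) * Complex.I * τ) with hp
  have hs0 : s ≠ 0 := Complex.exp_ne_zero _
  have hp0 : p ≠ 0 := Complex.exp_ne_zero _
  have hζ : zetaC z = s ^ 2 := by
    rw [zetaC, e2, hs, ← Complex.exp_nat_mul]
    push_cast
    ring_nf
  have hqp : qC τ = p ^ 2 := by
    rw [qC, e2, hp, ← Complex.exp_nat_mul]
    push_cast
    ring_nf
  have h1 : zetaC (z + τ) = qC τ * zetaC z := by
    rw [zetaC, e2_add, mul_comm, zetaC, qC]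
  have h2 : Complex.exp (-((Real.pi : ℂ) * Complex.I * (τ + 2 * z))) = p⁻¹ * (s ^ 2)⁻¹ := by
    rw [Complex.exp_neg, ← mul_inv, hs, hp, ← Complex.exp_nat_mul, ← Complex.exp_add]
    push_cast
    ring_nf
  have h3 : Complex.exp ((Real.pi : ℂ) * Complex.I * (z + τ)) = s * p := by
    rw [mul_add, Complex.exp_add]
  have h4 : qProd (qC τ) (zetaC (z + τ))⁻¹ =
      (1 - (s ^ 2)⁻¹) * qProd (qC τ) (zetaC z)⁻¹ := by
    have e1 : qC τ * (zetaC (z + τ))⁻¹ = (zetaC z)⁻¹ := by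
      rw [h1, hqp, mul_inv, mul_inv_cancel_left₀ (pow_ne_zero 2 hp0)]
    rw [qProd_eq_mul hq, e1, hζ]
  rw [theta_eq hτ, theta_eq hτ, h4, qProd_eq_mul hq (zetaC z), h2, h1, Complex.exp_neg,
    Complex.exp_neg, h3, ← hs, hqp, hζ]
  field_simp
  ring

lemma hasDerivAt_theta {τ : ℂ} (hτ : 0 < τ.im) :
    HasDerivAt (theta τ) (2 * Real.pi * Complex.I * eta τ ^ 3) 0 := by
  have hq := norm_qC_lt_one hτ
  have h : theta τ = fun z => _ := funext (theta_eq hτ)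
  have h1 : Differentiable ℂ (fun z => qProd (qC τ) (zetaC z)) :=
    (differentiable_qProd hq).comp differentiable_e2
  have h2 : Differentiable ℂ (fun z => qProd (qC τ) (zetaC z)⁻¹) :=
    (differentiable_qProd hq).comp (differentiable_e2.inv e2_ne_zero)
  have hG : Differentiable ℂ (fun z =>
      qProd (qC τ) (zetaC z) * qProd (qC τ) (zetaC z)⁻¹ * qProd (qC τ) 1) := by
    fun_prop
  have hA : HasDerivAt (fun z : ℂ => Complex.exp ((Real.pi : ℂ) * Complex.I * τ / 4) *
      (Complex.exp ((Real.pi : ℂ) * Complex.I * z) - Complex.exp (-((Real.pi : ℂ) * Complex.I * z))))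
      (Complex.exp ((Real.pi : ℂ) * Complex.I * τ / 4) * (2 * Real.pi * Complex.I)) 0 := by
    refine HasDerivAt.const_mul _ ?_
    have e1 : HasDerivAt (fun z : ℂ => (Real.pi : ℂ) * Complex.I * z) (Real.pi * Complex.I) 0 := by
      simpa using (hasDerivAt_id (0 : ℂ)).const_mul ((Real.pi : ℂ) * Complex.I)
    refine (e1.cexp.sub e1.neg.cexp).congr_deriv ?_
    simp
    ring
  have := hA.mul (hG 0).hasDerivAt
  rw [h]
  refine HasDerivAt.congr_deriv (f := fun z => _) this ?_
  have he : eta τ = Complex.exp ((Real.pi : ℂ) * Complex.I * τ / 12) * qProd (qC τ) 1 := by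
    simp [eta, qProd]
  have hz : zetaC 0 = 1 := e2_zero
  rw [he, mul_pow, ← Complex.exp_nat_mul, hz]
  simp
  ring_nf

lemma eta_ne_zero {τ : ℂ} (hτ : 0 < τ.im) : eta τ ≠ 0 := by
  have hq := norm_qC_lt_one hτ
  have he : eta τ = Complex.exp ((Real.pi : ℂ) * Complex.I * τ / 12) * qProd (qC τ) 1 := by
    simp [eta, qProd]
  rw [he]
  refine mul_ne_zero (Complex.exp_ne_zero _) (qProd_ne_zero hq fun n h => ?_)
  have : ‖qC τ ^ (n + 1)‖ < 1 := by
    rw [norm_pow]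
    exact pow_lt_one₀ (norm_nonneg _) hq (by simp)
  rw [mul_one] at h
  simp [h] at this

lemma e2_eq_one {x : ℂ} (h : e2 x = 1) : ∃ n : ℤ, x = n := by
  obtain ⟨n, hn⟩ := Complex.exp_eq_one_iff.1 h
  refine ⟨n, ?_⟩
  have : (2 * (Real.pi : ℂ) * Complex.I) ≠ 0 := Complex.two_pi_I_ne_zero
  refine mul_left_cancel₀ this ?_
  rw [hn]
  ring

lemma exists_of_theta_eq_zero {τ : ℂ} (hτ : 0 < τ.im) {z : ℂ} (h : theta τ z = 0) :
    ∃ x y : ℤ, z = x * τ + y := by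
  have hq := norm_qC_lt_one hτ
  rw [theta_eq hτ, mul_eq_zero, mul_eq_zero, mul_eq_zero, mul_eq_zero] at h
  rcases h with (h | h) | (h | h) | h
  · exact absurd h (Complex.exp_ne_zero _)
  · rw [sub_eq_zero, Complex.exp_eq_exp_iff_exists_int] at h
    obtain ⟨n, hn⟩ := h
    refine ⟨0, n, ?_⟩
    have : (2 * (Real.pi : ℂ) * Complex.I) ≠ 0 := Complex.two_pi_I_ne_zero
    refine mul_left_cancel₀ this ?_
    push_cast
    linear_combination hn
  · by_contra! hcon
    refine qProd_ne_zero hq (fun n hn => ?_) h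
    rw [qC, zetaC, ← e2_nat_mul, ← e2_add] at hn
    obtain ⟨y, hy⟩ := e2_eq_one hn
    refine hcon (-(n + 1)) y ?_
    push_cast at hy ⊢
    linear_combination hy
  · by_contra! hcon
    refine qProd_ne_zero hq (fun n hn => ?_) h
    rw [qC, zetaC, ← e2_neg, ← e2_nat_mul, ← e2_add] at hn
    obtain ⟨y, hy⟩ := e2_eq_one hn
    refine hcon (n + 1) (-y) ?_
    push_cast at hy ⊢
    linear_combination -hy
  · have := eta_ne_zero hτ
    refine absurd ?_ this
    simp only [eta, qProd, mul_one] at h ⊢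
    rw [h, mul_zero]

lemma tendsto_theta_div {τ : ℂ} (hτ : 0 < τ.im) :
    Tendsto (fun z => theta τ z / z) (𝓝[≠] 0) (𝓝 (2 * Real.pi * Complex.I * eta τ ^ 3)) := by
  have := (hasDerivAt_theta hτ).tendsto_slope
  refine this.congr fun z => ?_
  rw [slope_def_field, theta_zero, sub_zero, sub_zero]

lemma theta_deriv_ne_zero {τ : ℂ} (hτ : 0 < τ.im) :
    2 * (Real.pi : ℂ) * Complex.I * eta τ ^ 3 ≠ 0 :=
  mul_ne_zero Complex.two_pi_I_ne_zero (pow_ne_zero 3 (eta_ne_zero hτ))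

lemma eventually_theta_ne_zero {τ : ℂ} (hτ : 0 < τ.im) : ∀ᶠ z in 𝓝[≠] 0, theta τ z ≠ 0 :=
  ((tendsto_theta_div hτ).eventually_ne (theta_deriv_ne_zero hτ)).mono fun z hz h =>
    hz (by rw [h, zero_div])

end ThetaProduct

section ThetaSeries

open Filter Metric
open scoped Topology

local notation "π" => (Real.pi : ℂ)

/-- `jacobiTheta₂` is `1 + o(1)` at `i∞`. -/
lemma tendsto_jacobiTheta₂ (z : ℂ) :
    Tendsto (fun p : ℂ × ℂ => jacobiTheta₂ p.2 p.1) (imInf ×ˢ 𝓝 z) (𝓝 1) := by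
  have hsum := summable_pow_mul_jacobiTheta₂_term_bound (|z.im| + 1) one_pos 0
  have key := tendsto_tsum_of_dominated_convergence (𝓕 := imInf ×ˢ 𝓝 z)
    (f := fun (p : ℂ × ℂ) n => jacobiTheta₂_term n p.2 p.1)
    (g := fun n : ℤ => if n = 0 then 1 else 0)
    hsum ?_ ?_
  · simpa [jacobiTheta₂] using key
  · intro n
    rcases eq_or_ne n 0 with rfl | hn
    · simpa [jacobiTheta₂_term] using tendsto_const_nhds
    · simp only [hn, if_false]
      rw [tendsto_zero_iff_norm_tendsto_zero]
      simp only [norm_jacobiTheta₂_term]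
      have h1 : Tendsto (fun p : ℂ × ℂ => p.1.im) (imInf ×ˢ 𝓝 z) atTop :=
        tendsto_comap.comp tendsto_fst
      have h2 : Tendsto (fun p : ℂ × ℂ => -2 * Real.pi * n * p.2.im) (imInf ×ˢ 𝓝 z)
          (𝓝 (-2 * Real.pi * n * z.im)) :=
        ((Complex.continuous_im.tendsto z).comp tendsto_snd).const_mul _
      refine Real.tendsto_exp_atBot.comp ?_
      have h3 : Tendsto (fun p : ℂ × ℂ => -(Real.pi * n ^ 2 * p.1.im)) (imInf ×ˢ 𝓝 z) atBot :=
        tendsto_neg_atTop_atBot.comp (h1.const_mul_atTop (by positivity))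
      exact (h3.atBot_add h2).congr fun p => by ring
  · have hz : ∀ᶠ p in imInf ×ˢ 𝓝 z, |p.2.im| < |z.im| + 1 :=
      tendsto_snd.eventually ((Complex.continuous_im.abs.tendsto z).eventually_lt_const (by simp))
    filter_upwards [hz, tendsto_fst.eventually (eventually_imInf_gt 1)] with p hp hp1 n
    simpa using norm_jacobiTheta₂_term_le one_pos hp.le hp1.le n

/-- `jacobiTheta₂ (z + τ / 2) τ` is `1 + e^{-2πiz} + o(1)` at `i∞`. -/
lemma tendsto_jacobiTheta₂_add_half (z : ℂ) :
    Tendsto (fun p : ℂ × ℂ => jacobiTheta₂ (p.2 + p.1 / 2) p.1) (imInf ×ˢ 𝓝 z)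
      (𝓝 (1 + e2 (-z))) := by
  have hsum := summable_pow_mul_jacobiTheta₂_term_bound (|z.im| + 1 + 1 / 2) one_pos 0
  have key := tendsto_tsum_of_dominated_convergence (𝓕 := imInf ×ˢ 𝓝 z)
    (f := fun (p : ℂ × ℂ) n => jacobiTheta₂_term n (p.2 + p.1 / 2) p.1)
    (g := fun n : ℤ => (if n = 0 then 1 else 0) + (if n = -1 then e2 (-z) else 0))
    hsum ?_ ?_
  · rwa [Summable.tsum_add (summable_of_hasFiniteSupport ?_) (summable_of_hasFiniteSupport ?_),
      tsum_ite_eq, tsum_ite_eq] at key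
    · exact (Set.finite_singleton (0 : ℤ)).subset fun n hn => by
        by_contra h
        simp_all
    · exact (Set.finite_singleton (-1 : ℤ)).subset fun n hn => by
        by_contra h
        simp_all
  · intro n
    rcases eq_or_ne n 0 with rfl | hn
    · simpa [jacobiTheta₂_term] using tendsto_const_nhds
    rcases eq_or_ne n (-1) with rfl | hn1
    · simp only [hn, if_false, if_true, zero_add]
      refine ((continuous_e2.tendsto (-z)).comp (tendsto_snd.neg)).congr fun p => ?_
      simp only [jacobiTheta₂_term, Function.comp_apply, e2]
      congr 1
      push_cast
      ring
    · simp only [hn, hn1, if_false, add_zero]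
      rw [tendsto_zero_iff_norm_tendsto_zero]
      simp only [norm_jacobiTheta₂_term]
      have h1 : Tendsto (fun p : ℂ × ℂ => p.1.im) (imInf ×ˢ 𝓝 z) atTop :=
        tendsto_comap.comp tendsto_fst
      have h2 : Tendsto (fun p : ℂ × ℂ => -2 * Real.pi * n * p.2.im) (imInf ×ˢ 𝓝 z)
          (𝓝 (-2 * Real.pi * n * z.im)) :=
        ((Complex.continuous_im.tendsto z).comp tendsto_snd).const_mul _
      refine Real.tendsto_exp_atBot.comp ?_
      have hpos : 0 < Real.pi * ((n : ℝ) ^ 2 + n) := by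
        refine mul_pos Real.pi_pos ?_
        have : 0 < n ^ 2 + n := by
          rcases lt_or_gt_of_ne hn with h | h
          · have : n ≤ -2 := by lia
            nlinarith
          · nlinarith
        exact_mod_cast this
      have h3 : Tendsto (fun p : ℂ × ℂ => -(Real.pi * ((n : ℝ) ^ 2 + n) * p.1.im))
          (imInf ×ˢ 𝓝 z) atBot :=
        tendsto_neg_atTop_atBot.comp (h1.const_mul_atTop hpos)
      refine (h3.atBot_add h2).congr fun p => ?_
      have : (p.2 + p.1 / 2).im = p.2.im + p.1.im / 2 := by simp
      rw [this]
      ring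
  · have hz : ∀ᶠ p in imInf ×ˢ 𝓝 z, |p.2.im| < |z.im| + 1 :=
      tendsto_snd.eventually ((Complex.continuous_im.abs.tendsto z).eventually_lt_const (by simp))
    filter_upwards [hz, tendsto_fst.eventually (eventually_imInf_gt 1)] with p hp hp1 n
    have h1 := norm_jacobiTheta₂_term_le (z := p.2 + I / 2) (τ := I) one_pos
      (S := |z.im| + 1 + 1 / 2) (by
        simp only [add_im, div_ofNat_im, I_im]
        refine (abs_add_le _ _).trans (add_le_add hp.le ?_)
        norm_num) (by simp) n
    refine le_trans ?_ (by simpa using h1)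
    rw [norm_jacobiTheta₂_term, norm_jacobiTheta₂_term]
    refine Real.exp_le_exp.2 ?_
    have hpos : 0 ≤ (n : ℝ) ^ 2 + n := by
      have : 0 ≤ n ^ 2 + n := by
        rcases le_or_gt 0 n with h | h
        · positivity
        · have : n ≤ -1 := by lia
          nlinarith
      exact_mod_cast this
    have e1 : (p.2 + p.1 / 2).im = p.2.im + p.1.im / 2 := by simp
    have e2 : (p.2 + I / 2).im = p.2.im + 1 / 2 := by simp
    rw [e1, e2, I_im]
    have := mul_nonneg (mul_nonneg Real.pi_pos.le hpos) (sub_nonneg.2 hp1.le)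
    nlinarith

lemma jacobiTheta₂_add_one_right (z τ : ℂ) :
    jacobiTheta₂ z (τ + 1) = jacobiTheta₂ (z + 1 / 2) τ := by
  refine tsum_congr fun n => ?_
  rw [jacobiTheta₂_term, jacobiTheta₂_term, Complex.exp_eq_exp_iff_exists_int]
  obtain ⟨k, hk⟩ := Int.even_mul_pred_self n
  refine ⟨k, ?_⟩
  have hk' : (n : ℂ) * (n - 1) = k + k := by exact_mod_cast hk
  linear_combination (π * I) * hk'

lemma jacobiTheta₂_inv {τ : ℂ} (hτ : 0 < τ.im) (z : ℂ) :
    jacobiTheta₂ (z / τ) (-1 / τ) =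
      (-I * τ) ^ (1 / 2 : ℂ) * Complex.exp (π * I * z ^ 2 / τ) * jacobiTheta₂ z τ := by
  have h0 : (-I * τ) ^ (1 / 2 : ℂ) ≠ 0 := by
    rw [Complex.cpow_ne_zero_iff]
    left
    simpa using ne_zero_of_im_pos hτ
  rw [jacobiTheta₂_functional_equation z τ]
  have : Complex.exp (-π * I * z ^ 2 / τ) = (Complex.exp (π * I * z ^ 2 / τ))⁻¹ := by
    rw [← Complex.exp_neg]
    ring_nf
  rw [this]
  have hE := Complex.exp_ne_zero (π * I * z ^ 2 / τ)
  generalize Complex.exp (π * I * z ^ 2 / τ) = E at hE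
  generalize (-I * τ) ^ (1 / 2 : ℂ) = A at h0
  field_simp

lemma neg_exp_eq (x : ℂ) : -Complex.exp x = Complex.exp (x + π * I) := by
  rw [Complex.exp_add, Complex.exp_pi_mul_I, mul_neg_one]

/-- The odd Jacobi theta function as a series, up to a factor depending only on `τ`. -/
def oddTheta (τ z : ℂ) : ℂ :=
  Complex.exp (π * I * z) * jacobiTheta₂ (z + (τ + 1) / 2) τ

lemma oddTheta_add_one_right (τ z : ℂ) : oddTheta τ (z + 1) = -1 * oddTheta τ z := by
  have h : z + 1 + (τ + 1) / 2 = z + (τ + 1) / 2 + 1 := by ring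
  rw [oddTheta, h, jacobiTheta₂_add_left, mul_add, Complex.exp_add, mul_one, Complex.exp_pi_mul_I,
    oddTheta]
  ring

lemma oddTheta_add_tau_right (τ z : ℂ) :
    oddTheta τ (z + τ) = -Complex.exp (-(π * I * (τ + 2 * z))) * oddTheta τ z := by
  have h : z + τ + (τ + 1) / 2 = z + (τ + 1) / 2 + τ := by ring
  rw [oddTheta, h, jacobiTheta₂_add_left', oddTheta, ← mul_assoc, ← mul_assoc, ← Complex.exp_add]
  congr 1
  rw [neg_exp_eq, ← Complex.exp_add, Complex.exp_eq_exp_iff_exists_int]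
  exact ⟨-1, by push_cast; ring⟩

lemma oddTheta_neg (τ z : ℂ) : oddTheta τ (-z) = -oddTheta τ z := by
  have h1 : -z + (τ + 1) / 2 = -(z - (τ + 1) / 2) := by ring
  have h2 : z + (τ + 1) / 2 = z - (τ + 1) / 2 + 1 + τ := by ring
  rw [oddTheta, oddTheta, h1, jacobiTheta₂_neg_left, h2, jacobiTheta₂_add_left',
    jacobiTheta₂_add_left, ← mul_assoc, ← Complex.exp_add, ← neg_mul, neg_exp_eq]
  congr 1
  rw [Complex.exp_eq_exp_iff_exists_int]
  exact ⟨0, by push_cast; ring⟩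

lemma oddTheta_zero (τ : ℂ) : oddTheta τ 0 = 0 := by
  have := oddTheta_neg τ 0
  rwa [neg_zero, self_eq_neg] at this

lemma oddTheta_add_one (τ z : ℂ) : oddTheta (τ + 1) z = oddTheta τ z := by
  have h : z + (τ + 1 + 1) / 2 + 1 / 2 = z + (τ + 1) / 2 + 1 := by ring
  rw [oddTheta, jacobiTheta₂_add_one_right, h, jacobiTheta₂_add_left, oddTheta]

/-- The automorphy factor of `oddTheta` under inversion. -/
def oddThetaFactor (τ : ℂ) : ℂ :=
  (-I * τ) ^ (1 / 2 : ℂ) * Complex.exp (π * I * (τ - 1) ^ 2 / (4 * τ))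

lemma oddThetaFactor_ne_zero {τ : ℂ} (hτ : 0 < τ.im) : oddThetaFactor τ ≠ 0 := by
  refine mul_ne_zero ?_ (Complex.exp_ne_zero _)
  rw [Complex.cpow_ne_zero_iff]
  left
  simpa using ne_zero_of_im_pos hτ

lemma oddTheta_inv {τ : ℂ} (hτ : 0 < τ.im) (z : ℂ) :
    oddTheta (-1 / τ) (z / τ) =
      oddThetaFactor τ * Complex.exp (π * I * z ^ 2 / τ) * oddTheta τ z := by
  have h0 := ne_zero_of_im_pos hτ
  have h1 : z / τ + (-1 / τ + 1) / 2 = (z + (τ - 1) / 2) / τ := by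
    field_simp
    ring
  have h2 : z + (τ + 1) / 2 = z + (τ - 1) / 2 + 1 := by ring
  rw [oddTheta, h1, jacobiTheta₂_inv hτ, oddTheta, h2, jacobiTheta₂_add_left, oddThetaFactor]
  have h3 : Complex.exp (π * I * (z / τ)) * Complex.exp (π * I * (z + (τ - 1) / 2) ^ 2 / τ) =
      Complex.exp (π * I * (τ - 1) ^ 2 / (4 * τ)) * Complex.exp (π * I * z ^ 2 / τ) *
        Complex.exp (π * I * z) := by
    rw [← Complex.exp_add, ← Complex.exp_add, ← Complex.exp_add]
    congr 1
    field_simp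
    ring
  linear_combination ((-I * τ) ^ (1 / 2 : ℂ) * jacobiTheta₂ (z + (τ - 1) / 2) τ) * h3

lemma differentiableAt_jacobiTheta₂_comp {τ : ℂ} (hτ : 0 < τ.im) {f : ℂ → ℂ}
    (hf : DifferentiableAt ℂ f τ) : DifferentiableAt ℂ (fun t => jacobiTheta₂ (f t) t) τ :=
  ((hasFDerivAt_jacobiTheta₂ (f τ) hτ).differentiableAt).comp
    (f := fun t => (f t, t)) τ (hf.prodMk differentiableAt_id)

lemma continuousAt_jacobiTheta₂_comp {τ z : ℂ} (hτ : 0 < τ.im) {f : ℂ × ℂ → ℂ}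
    (hf : ContinuousAt f (τ, z)) :
    ContinuousAt (fun p : ℂ × ℂ => jacobiTheta₂ (f p) p.1) (τ, z) :=
  (continuousAt_jacobiTheta₂ (f (τ, z)) hτ).comp (f := fun p : ℂ × ℂ => (f p, p.1))
    (hf.prodMk continuousAt_fst)

lemma differentiable_jacobiTheta₂_comp {τ : ℂ} (hτ : 0 < τ.im) {f : ℂ → ℂ}
    (hf : Differentiable ℂ f) : Differentiable ℂ (fun z => jacobiTheta₂ (f z) τ) := fun z =>
  (differentiableAt_jacobiTheta₂_fst (f z) hτ).comp z (hf z)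

lemma continuousAt_oddTheta {τ : ℂ} (hτ : 0 < τ.im) (z : ℂ) :
    ContinuousAt (fun p : ℂ × ℂ => oddTheta p.1 p.2) (τ, z) := by
  have := continuousAt_jacobiTheta₂_comp (z := z) hτ (f := fun p => p.2 + (p.1 + 1) / 2)
    (by fun_prop)
  exact ContinuousAt.mul (by fun_prop) this

lemma differentiableAt_oddTheta_fst {τ : ℂ} (hτ : 0 < τ.im) (z : ℂ) :
    DifferentiableAt ℂ (fun t => oddTheta t z) τ :=
  (differentiableAt_jacobiTheta₂_comp hτ (f := fun t => z + (t + 1) / 2) (by fun_prop)).const_mul _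

lemma differentiable_oddTheta {τ : ℂ} (hτ : 0 < τ.im) : Differentiable ℂ (oddTheta τ) := by
  have := differentiable_jacobiTheta₂_comp hτ (f := fun z => z + (τ + 1) / 2) (by fun_prop)
  exact Differentiable.mul (by fun_prop) this

/-- The leading term of `oddTheta` at `i∞`. -/
def sinTerm (z : ℂ) : ℂ := Complex.exp (π * I * z) - Complex.exp (-(π * I * z))

lemma tendsto_oddTheta (z : ℂ) :
    Tendsto (fun p : ℂ × ℂ => oddTheta p.1 p.2) (imInf ×ˢ 𝓝 z) (𝓝 (sinTerm z)) := by
  have h1 : Tendsto (fun p : ℂ × ℂ => (p.1, p.2 + 1 / 2)) (imInf ×ˢ 𝓝 z)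
      (imInf ×ˢ 𝓝 (z + 1 / 2)) :=
    tendsto_fst.prodMk (tendsto_snd.add_const _)
  have h2 := (tendsto_jacobiTheta₂_add_half (z + 1 / 2)).comp h1
  have h3 : Tendsto (fun p : ℂ × ℂ => Complex.exp (π * I * p.2)) (imInf ×ˢ 𝓝 z)
      (𝓝 (Complex.exp (π * I * z))) :=
    ((show Continuous fun w : ℂ => Complex.exp (π * I * w) by fun_prop).tendsto z).comp tendsto_snd
  have h4 := h3.mul h2
  have h5 : Complex.exp (π * I * z) * (1 + e2 (-(z + 1 / 2))) = sinTerm z := by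
    rw [sinTerm, mul_add, mul_one, e2, ← Complex.exp_add, sub_eq_add_neg, ← neg_one_mul
      (Complex.exp (-(π * I * z))), ← Complex.exp_pi_mul_I, ← Complex.exp_add]
    congr 1
    rw [Complex.exp_eq_exp_iff_exists_int]
    exact ⟨-1, by push_cast; ring⟩
  rw [h5] at h4
  refine h4.congr fun p => ?_
  simp only [oddTheta, Function.comp_apply]
  congr 2
  ring

/-- The derivative of `oddTheta τ` at the origin. -/
def oddThetaDeriv (τ : ℂ) : ℂ := deriv (oddTheta τ) 0

lemma tendsto_oddTheta_div {τ : ℂ} (hτ : 0 < τ.im) :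
    Tendsto (fun z => oddTheta τ z / z) (𝓝[≠] 0) (𝓝 (oddThetaDeriv τ)) := by
  have := (differentiable_oddTheta hτ 0).hasDerivAt.tendsto_slope
  refine this.congr fun z => ?_
  rw [slope_def_field, oddTheta_zero, sub_zero, sub_zero]

lemma hasDerivAt_sinTerm : HasDerivAt sinTerm (2 * π * I) 0 := by
  have e1 : HasDerivAt (fun z : ℂ => π * I * z) (π * I) 0 := by
    simpa using (hasDerivAt_id (0 : ℂ)).const_mul (π * I)
  refine (e1.cexp.sub e1.neg.cexp).congr_deriv ?_
  simp
  ring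

lemma differentiable_sinTerm : Differentiable ℂ sinTerm := by
  unfold sinTerm
  fun_prop

lemma tameFamily_oddTheta_sub : TameFamily fun τ z => oddTheta τ z - sinTerm z := by
  refine .of_tendsto (fun τ z hτ => ?_) (fun τ z hτ => ?_) (fun τ z hτ => ?_) fun z => ?_
  · exact (continuousAt_oddTheta hτ z).sub
      (differentiable_sinTerm.continuous.comp continuous_snd).continuousAt
  · exact (differentiableAt_oddTheta_fst hτ z).sub_const _
  · exact (differentiable_oddTheta hτ z).sub (differentiable_sinTerm z)
  · have := (tendsto_oddTheta z).sub
      ((differentiable_sinTerm.continuous.tendsto z).comp tendsto_snd)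
    simpa using this

lemma tameFamily_dslope_oddTheta_sub :
    TameFamily fun τ => dslope (fun z => oddTheta τ z - sinTerm z) 0 :=
  tameFamily_oddTheta_sub.dslope fun τ _ => by simp [oddTheta_zero, sinTerm]

lemma dslope_oddTheta_sub_zero {τ : ℂ} (hτ : 0 < τ.im) :
    dslope (fun z => oddTheta τ z - sinTerm z) 0 0 = oddThetaDeriv τ - 2 * π * I := by
  rw [dslope_same]
  exact ((differentiable_oddTheta hτ 0).hasDerivAt.sub hasDerivAt_sinTerm).deriv

lemma differentiableAt_oddThetaDeriv {τ : ℂ} (hτ : 0 < τ.im) :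
    DifferentiableAt ℂ oddThetaDeriv τ := by
  have h := (tameFamily_dslope_oddTheta_sub.differentiableAt τ 0 hτ).add_const (2 * π * I)
  refine h.congr_of_eventuallyEq ?_
  filter_upwards [isOpen_im_pos.mem_nhds hτ] with t ht
  rw [dslope_oddTheta_sub_zero ht, sub_add_cancel]

lemma tendsto_oddThetaDeriv : Tendsto oddThetaDeriv imInf (𝓝 (2 * π * I)) := by
  rw [tendsto_iff_norm_sub_tendsto_zero, Metric.tendsto_nhds]
  intro ε hε
  filter_upwards [tameFamily_dslope_oddTheta_sub.tendsto (ε / 2) (by positivity),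
    eventually_imInf_gt 0] with t ht ht0
  have := ht 0 (by simp)
  rw [dslope_oddTheta_sub_zero ht0] at this
  simp only [dist_zero_right, norm_norm]
  linarith

lemma oddThetaDeriv_add_one (τ : ℂ) : oddThetaDeriv (τ + 1) = oddThetaDeriv τ := by
  rw [oddThetaDeriv, funext (oddTheta_add_one τ), oddThetaDeriv]

lemma oddThetaDeriv_inv {τ : ℂ} (hτ : 0 < τ.im) :
    oddThetaDeriv (-1 / τ) = τ * oddThetaFactor τ * oddThetaDeriv τ := by
  have h0 := ne_zero_of_im_pos hτ
  have hdiv : Tendsto (fun z : ℂ => z / τ) (𝓝[≠] 0) (𝓝[≠] 0) := by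
    refine tendsto_nhdsWithin_iff.2 ⟨?_, ?_⟩
    · exact (Continuous.tendsto' (by fun_prop) _ _ (by simp)).mono_left nhdsWithin_le_nhds
    · filter_upwards [self_mem_nhdsWithin] with z hz
      exact div_ne_zero hz h0
  have h1 := (tendsto_oddTheta_div (im_neg_one_div_pos hτ)).comp hdiv
  have h2 : Tendsto (fun z : ℂ => Complex.exp (π * I * z ^ 2 / τ)) (𝓝[≠] 0) (𝓝 1) :=
    (Continuous.tendsto' (by fun_prop) _ _ (by simp)).mono_left nhdsWithin_le_nhds
  have h3 := (h2.const_mul (τ * oddThetaFactor τ)).mul (tendsto_oddTheta_div hτ)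
  rw [mul_one] at h3
  refine tendsto_nhds_unique h1 (h3.congr fun z => ?_)
  rw [Function.comp_apply, oddTheta_inv hτ]
  field_simp

end ThetaSeries

section ThetaComparison

open Filter Metric
open scoped Topology

local notation "π" => (Real.pi : ℂ)

lemma integral_jacobiTheta₂ {τ : ℂ} (hτ : 0 < τ.im) :
    ∫ x in (0 : ℝ)..1, jacobiTheta₂ x τ = 1 := by
  have hb : Summable fun n : ℤ => ‖jacobiTheta₂_term n 0 τ‖ :=
    ((summable_jacobiTheta₂_term_iff 0 τ).2 hτ).norm
  have hsum := intervalIntegral.hasSum_integral_of_dominated_convergence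
    (a := 0) (b := 1) (μ := MeasureTheory.volume)
    (F := fun (n : ℤ) (x : ℝ) => jacobiTheta₂_term n x τ) (f := fun x => jacobiTheta₂ x τ)
    (fun n _ => ‖jacobiTheta₂_term n 0 τ‖)
    (fun n => by
      have : Continuous fun x : ℝ => jacobiTheta₂_term n x τ := by
        unfold jacobiTheta₂_term
        fun_prop
      exact this.aestronglyMeasurable)
    (fun n => .of_forall fun x _ => by simp [norm_jacobiTheta₂_term])
    (.of_forall fun x _ => hb) intervalIntegrable_const
    (.of_forall fun x _ => hasSum_jacobiTheta₂_term _ hτ)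
  refine hsum.unique ?_
  have hterm : ∀ n : ℤ, ∫ x in (0 : ℝ)..1, jacobiTheta₂_term n x τ = if n = 0 then 1 else 0 := by
    intro n
    have h1 : ∀ x : ℝ, jacobiTheta₂_term n x τ =
        Complex.exp (π * I * n ^ 2 * τ) * Complex.exp (2 * π * I * n * x) := fun x => by
      rw [jacobiTheta₂_term, ← Complex.exp_add, add_comm]
    simp only [h1, intervalIntegral.integral_const_mul]
    split_ifs with h
    · simp [h]
    · have hc : 2 * π * I * n ≠ 0 := mul_ne_zero Complex.two_pi_I_ne_zero (by exact_mod_cast h)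
      rw [integral_exp_mul_complex hc]
      have : Complex.exp (2 * π * I * n * (1 : ℝ)) = 1 := by
        rw [Complex.exp_eq_one_iff]
        exact ⟨n, by push_cast; ring⟩
      rw [this]
      simp
  simp only [hterm]
  exact hasSum_ite_eq 0 1

lemma oddTheta_eq {τ : ℂ} (hτ : 0 < τ.im) (z : ℂ) :
    oddTheta τ z = oddThetaDeriv τ / (2 * π * I * eta τ ^ 3) * theta τ z := by
  have hne := theta_deriv_ne_zero hτ
  set c := oddThetaDeriv τ / (2 * π * I * eta τ ^ 3) with hc
  rw [← sub_eq_zero]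
  refine eq_zero_of_quasiperiodic hτ (f := fun z => oddTheta τ z - c * theta τ z) (θ := theta τ)
    (a := fun _ => -1) (b := fun z => -Complex.exp (-(π * I * (τ + 2 * z))))
    ((differentiable_oddTheta hτ).sub ((differentiable_theta hτ).const_mul c))
    (differentiable_theta hτ) (fun _ => by norm_num)
    (fun z => neg_ne_zero.2 (Complex.exp_ne_zero _)) (fun z => ?_) (theta_add_one hτ) (fun z => ?_)
    (theta_add_tau hτ) (fun z => exists_of_theta_eq_zero hτ) (theta_zero τ)
    (eventually_theta_ne_zero hτ) ?_ z
  · rw [oddTheta_add_one_right, theta_add_one hτ]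
    ring
  · rw [oddTheta_add_tau_right, theta_add_tau hτ]
    ring
  · have h := ((tendsto_oddTheta_div hτ).div (tendsto_theta_div hτ) hne).sub_const c
    rw [← hc, sub_self] at h
    clear_value c
    refine h.congr' ?_
    filter_upwards [eventually_theta_ne_zero hτ, self_mem_nhdsWithin] with w hw hw0
    have : w ≠ 0 := hw0
    change oddTheta τ w / w / (theta τ w / w) - _ = _
    rw [sub_div, mul_div_cancel_right₀ _ hw, div_div_div_cancel_right₀ this]

lemma oddThetaDeriv_ne_zero {τ : ℂ} (hτ : 0 < τ.im) : oddThetaDeriv τ ≠ 0 := by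
  intro h
  have h0 : ∀ z, jacobiTheta₂ z τ = 0 := fun z => by
    have := oddTheta_eq hτ (z - (τ + 1) / 2)
    rw [h, zero_div, zero_mul, oddTheta, sub_add_cancel] at this
    exact (mul_eq_zero.1 this).resolve_left (Complex.exp_ne_zero _)
  have := integral_jacobiTheta₂ hτ
  simp [h0] at this

lemma phiM21_eq {τ : ℂ} (hτ : 0 < τ.im) (z : ℂ) :
    phiM21 τ z = (2 * π * I) ^ 2 * oddTheta τ z ^ 2 / oddThetaDeriv τ ^ 2 := by
  have h1 := theta_deriv_ne_zero hτ
  have h2 := oddThetaDeriv_ne_zero hτ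
  have h3 := eta_ne_zero hτ
  have h4 := Complex.two_pi_I_ne_zero
  rw [oddTheta_eq hτ, phiM21]
  generalize 2 * π * I = c at h4
  field_simp

lemma exp_sq_eq_e2 (x : ℂ) : Complex.exp x ^ 2 = e2 (x / (π * I)) := by
  have : π * I ≠ 0 := mul_ne_zero (by exact_mod_cast Real.pi_ne_zero) I_ne_zero
  rw [← Complex.exp_nat_mul, e2]
  congr 1
  field_simp
  push_cast
  ring

lemma jacobiLike_phiM21 : JacobiLike (-2) 1 phiM21 fun z => sinTerm z ^ 2 := by
  refine JacobiLike.congr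
    (φ := fun τ z => (2 * π * I) ^ 2 * oddTheta τ z ^ 2 / oddThetaDeriv τ ^ 2) ?_
    fun τ z hτ => phiM21_eq hτ z
  have hpi : π ≠ 0 := by exact_mod_cast Real.pi_ne_zero
  refine ⟨fun τ z hτ => ?_, fun τ z hτ => ?_, fun τ z hτ => ?_, fun τ z hτ => ?_, fun τ z hτ => ?_,
    fun τ z hτ => ?_, fun τ z hτ => ?_, fun z => ?_⟩
  · have h := (differentiableAt_oddThetaDeriv hτ).continuousAt
    have h2 : ContinuousAt (fun p : ℂ × ℂ => oddThetaDeriv p.1) (τ, z) :=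
      ContinuousAt.comp (x := (τ, z)) (f := fun p : ℂ × ℂ => p.1) (g := oddThetaDeriv) h
        continuousAt_fst
    exact (((continuousAt_oddTheta hτ z).pow 2).const_mul _).div (h2.pow 2)
      (pow_ne_zero 2 (oddThetaDeriv_ne_zero hτ))
  · exact (((differentiableAt_oddTheta_fst hτ z).pow 2).const_mul _).div
      ((differentiableAt_oddThetaDeriv hτ).pow 2) (pow_ne_zero 2 (oddThetaDeriv_ne_zero hτ))
  · exact (((differentiable_oddTheta hτ z).pow 2).const_mul _).div_const _
  · simp only [oddTheta_add_one, oddThetaDeriv_add_one]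
  · have h1 := ne_zero_of_im_pos hτ
    have h2 := oddThetaDeriv_ne_zero hτ
    have h3 := oddThetaFactor_ne_zero hτ
    have h4 : e2 ((1 : ℤ) * z ^ 2 / τ) = Complex.exp (π * I * z ^ 2 / τ) ^ 2 := by
      rw [exp_sq_eq_e2]
      congr 1
      push_cast
      field_simp
    simp only [oddTheta_inv hτ, oddThetaDeriv_inv hτ, h4, zpow_neg]
    generalize Complex.exp (π * I * z ^ 2 / τ) = E
    rw [show τ ^ (2 : ℤ) = τ ^ 2 from rfl]
    field_simp
  · simp only [oddTheta_add_one_right]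
    ring
  · have h4 : e2 (-(1 : ℤ) * (τ + 2 * z)) = Complex.exp (-(π * I * (τ + 2 * z))) ^ 2 := by
      rw [exp_sq_eq_e2]
      congr 1
      push_cast
      field_simp
    simp only [oddTheta_add_tau_right, h4]
    ring
  · have h1 := ((tendsto_oddTheta z).pow 2).const_mul ((2 * π * I) ^ 2)
    have h2 := (tendsto_oddThetaDeriv.comp (tendsto_fst (g := 𝓝 z))).pow 2
    have h3 := h1.div h2 (pow_ne_zero 2 Complex.two_pi_I_ne_zero)
    rwa [mul_div_cancel_left₀ _ (pow_ne_zero 2 Complex.two_pi_I_ne_zero)] at h3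

lemma exists_of_jacobiTheta₂_eq_zero {τ w : ℂ} (hτ : 0 < τ.im) (h : jacobiTheta₂ w τ = 0) :
    ∃ x y : ℤ, w = (x + 1 / 2) * τ + (y + 1 / 2) := by
  have h1 := oddTheta_eq hτ (w - (τ + 1) / 2)
  rw [oddTheta, sub_add_cancel, h, mul_zero, eq_comm, mul_eq_zero, or_iff_right
    (div_ne_zero (oddThetaDeriv_ne_zero hτ) (theta_deriv_ne_zero hτ))] at h1
  obtain ⟨x, y, hxy⟩ := exists_of_theta_eq_zero hτ h1
  exact ⟨x, y, by linear_combination hxy⟩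

end ThetaComparison

section EvenTheta

open Filter Metric
open scoped Topology

local notation "π" => (Real.pi : ℂ)

lemma theta00_eq (τ z : ℂ) : theta00 τ z = jacobiTheta₂ z τ := by
  refine tsum_congr fun n => ?_
  rw [jacobiTheta₂_term]
  ring_nf

lemma theta01_eq (τ z : ℂ) : theta01 τ z = jacobiTheta₂ (z + 1 / 2) τ := by
  refine tsum_congr fun n => ?_
  rw [jacobiTheta₂_term, ← Complex.exp_pi_mul_I, ← Complex.exp_int_mul, ← Complex.exp_add]
  ring_nf

lemma theta10_eq (τ z : ℂ) :
    theta10 τ z =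
      Complex.exp (π * I * τ / 4) * (Complex.exp (π * I * z) * jacobiTheta₂ (z + τ / 2) τ) := by
  rw [theta10, mul_assoc]
  congr 2
  refine tsum_congr fun n => ?_
  rw [jacobiTheta₂_term]
  ring_nf

lemma xi00_eq (τ z : ℂ) : xi00 τ z = jacobiTheta₂ z τ / jacobiTheta₂ 0 τ := by
  rw [xi00, theta00_eq, theta00_eq]

lemma xi01_eq (τ z : ℂ) : xi01 τ z = jacobiTheta₂ (z + 1 / 2) τ / jacobiTheta₂ (1 / 2) τ := by
  rw [xi01, theta01_eq, theta01_eq, zero_add]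

lemma xi10_eq (τ z : ℂ) :
    xi10 τ z = Complex.exp (π * I * z) * jacobiTheta₂ (z + τ / 2) τ / jacobiTheta₂ (τ / 2) τ := by
  rw [xi10, theta10_eq, theta10_eq, zero_add, mul_div_mul_left _ _ (Complex.exp_ne_zero _)]
  simp

lemma jacobiTheta₂_zero_ne_zero {τ : ℂ} (hτ : 0 < τ.im) : jacobiTheta₂ 0 τ ≠ 0 := fun h => by
  obtain ⟨x, y, hxy⟩ := exists_of_jacobiTheta₂_eq_zero hτ h
  have := congrArg im hxy
  simp [hτ.ne'] at this
  have h2 : (2 * x + 1 : ℝ) = 0 := by linarith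
  norm_cast at h2
  lia

lemma jacobiTheta₂_one_half_ne_zero {τ : ℂ} (hτ : 0 < τ.im) : jacobiTheta₂ (1 / 2) τ ≠ 0 :=
  fun h => by
  obtain ⟨x, y, hxy⟩ := exists_of_jacobiTheta₂_eq_zero hτ h
  have := congrArg im hxy
  simp [hτ.ne'] at this
  have h2 : (2 * x + 1 : ℝ) = 0 := by linarith
  norm_cast at h2
  lia

lemma jacobiTheta₂_half_ne_zero {τ : ℂ} (hτ : 0 < τ.im) : jacobiTheta₂ (τ / 2) τ ≠ 0 :=
  fun h => by
  obtain ⟨x, y, hxy⟩ := exists_of_jacobiTheta₂_eq_zero hτ h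
  have hx : (x : ℝ) = 0 := by
    have := congrArg im hxy
    simp at this
    have h2 : (x : ℝ) * τ.im = 0 := by linarith
    exact (mul_eq_zero.1 h2).resolve_right hτ.ne'
  have hx' : (x : ℂ) = 0 := by exact_mod_cast hx
  rw [hx'] at hxy
  have h2 : (2 * y + 1 : ℂ) = 0 := by linear_combination -2 * hxy
  norm_cast at h2
  lia

lemma xi00_add_one (τ z : ℂ) : xi00 (τ + 1) z = xi01 τ z := by
  rw [xi00_eq, xi01_eq, jacobiTheta₂_add_one_right, jacobiTheta₂_add_one_right, zero_add]

lemma xi01_add_one (τ z : ℂ) : xi01 (τ + 1) z = xi00 τ z := by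
  have h1 : z + 1 / 2 + 1 / 2 = z + 1 := by ring
  have h2 : (1 / 2 + 1 / 2 : ℂ) = 0 + 1 := by norm_num
  rw [xi00_eq, xi01_eq, jacobiTheta₂_add_one_right, jacobiTheta₂_add_one_right, h1, h2,
    jacobiTheta₂_add_left, jacobiTheta₂_add_left]

lemma xi10_add_one (τ z : ℂ) : xi10 (τ + 1) z = xi10 τ z := by
  have h1 : z + (τ + 1) / 2 + 1 / 2 = z + τ / 2 + 1 := by ring
  have h2 : (τ + 1) / 2 + 1 / 2 = τ / 2 + 1 := by ring
  rw [xi10_eq, xi10_eq, jacobiTheta₂_add_one_right, jacobiTheta₂_add_one_right, h1, h2,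
    jacobiTheta₂_add_left, jacobiTheta₂_add_left]

lemma cpow_half_ne_zero {τ : ℂ} (hτ : 0 < τ.im) : (-I * τ) ^ (1 / 2 : ℂ) ≠ 0 := by
  rw [Complex.cpow_ne_zero_iff]
  left
  simpa using ne_zero_of_im_pos hτ

lemma xi00_inv {τ : ℂ} (hτ : 0 < τ.im) (z : ℂ) :
    xi00 (-1 / τ) (z / τ) = Complex.exp (π * I * z ^ 2 / τ) * xi00 τ z := by
  have h0 := jacobiTheta₂_inv hτ 0
  rw [zero_div, zero_pow two_ne_zero, mul_zero, zero_div, Complex.exp_zero, mul_one] at h0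
  rw [xi00_eq, xi00_eq, jacobiTheta₂_inv hτ, h0, mul_assoc,
    mul_div_mul_left _ _ (cpow_half_ne_zero hτ), mul_div_assoc]

lemma xi01_inv {τ : ℂ} (hτ : 0 < τ.im) (z : ℂ) :
    xi01 (-1 / τ) (z / τ) = Complex.exp (π * I * z ^ 2 / τ) * xi10 τ z := by
  have hτ0 := ne_zero_of_im_pos hτ
  have h1 := jacobiTheta₂_half_ne_zero hτ
  have h2 := cpow_half_ne_zero hτ
  have h3 : z / τ + 1 / 2 = (z + τ / 2) / τ := by field_simp
  have h4 : τ / 2 / τ = 1 / 2 := by field_simp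
  have h5 : Complex.exp (π * I * (z + τ / 2) ^ 2 / τ) =
      Complex.exp (π * I * z ^ 2 / τ) * Complex.exp (π * I * z) *
        Complex.exp (π * I * (τ / 2) ^ 2 / τ) := by
    rw [← Complex.exp_add, ← Complex.exp_add]
    congr 1
    field_simp
    ring
  have h6 := jacobiTheta₂_inv hτ (τ / 2)
  rw [h4] at h6
  rw [xi01_eq, xi10_eq, h3, h6, jacobiTheta₂_inv hτ, h5]
  have h7 := Complex.exp_ne_zero (π * I * (τ / 2) ^ 2 / τ)
  generalize (-I * τ) ^ (1 / 2 : ℂ) = A at h2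
  generalize Complex.exp (π * I * (τ / 2) ^ 2 / τ) = B at h7
  generalize Complex.exp (π * I * z ^ 2 / τ) = C
  field_simp

lemma xi10_inv {τ : ℂ} (hτ : 0 < τ.im) (z : ℂ) :
    xi10 (-1 / τ) (z / τ) = Complex.exp (π * I * z ^ 2 / τ) * xi01 τ z := by
  have hτ0 := ne_zero_of_im_pos hτ
  have h1 := jacobiTheta₂_one_half_ne_zero hτ
  have h2 := cpow_half_ne_zero hτ
  have h3 : z / τ + -1 / τ / 2 = (z - 1 / 2) / τ := by field_simp; ring
  have h4 : -1 / τ / 2 = (-(1 / 2)) / τ := by field_simp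
  have h5 : Complex.exp (π * I * (z / τ)) * Complex.exp (π * I * (z - 1 / 2) ^ 2 / τ) =
      Complex.exp (π * I * z ^ 2 / τ) * Complex.exp (π * I * (-(1 / 2)) ^ 2 / τ) := by
    rw [← Complex.exp_add, ← Complex.exp_add]
    congr 1
    field_simp
    ring
  have h6 : z + 1 / 2 = z - 1 / 2 + 1 := by ring
  rw [xi01_eq, xi10_eq, h3, h4, jacobiTheta₂_inv hτ, jacobiTheta₂_inv hτ, h6,
    jacobiTheta₂_add_left, jacobiTheta₂_neg_left]
  have h7 := Complex.exp_ne_zero (π * I * (-(1 / 2)) ^ 2 / τ)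
  generalize (-I * τ) ^ (1 / 2 : ℂ) = A at h2
  generalize Complex.exp (π * I * (-(1 / 2)) ^ 2 / τ) = B at h5 h7
  generalize Complex.exp (π * I * z ^ 2 / τ) = C at h5
  generalize Complex.exp (π * I * (z - 1 / 2) ^ 2 / τ) = D at h5
  generalize Complex.exp (π * I * (z / τ)) = E at h5
  generalize jacobiTheta₂ (1 / 2) τ = F at h1
  generalize jacobiTheta₂ (z - 1 / 2) τ = G
  field_simp
  linear_combination G * h5

lemma xi00_add_one_right (τ z : ℂ) : xi00 τ (z + 1) = xi00 τ z := by
  rw [xi00_eq, jacobiTheta₂_add_left, xi00_eq]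

lemma xi01_add_one_right (τ z : ℂ) : xi01 τ (z + 1) = xi01 τ z := by
  rw [xi01_eq, add_right_comm, jacobiTheta₂_add_left, xi01_eq]

lemma xi10_add_one_right (τ z : ℂ) : xi10 τ (z + 1) = -xi10 τ z := by
  rw [xi10_eq, add_right_comm, jacobiTheta₂_add_left, xi10_eq, mul_add, Complex.exp_add, mul_one,
    Complex.exp_pi_mul_I]
  ring

lemma xi00_add_tau_right (τ z : ℂ) :
    xi00 τ (z + τ) = Complex.exp (-(π * I * (τ + 2 * z))) * xi00 τ z := by
  rw [xi00_eq, jacobiTheta₂_add_left', xi00_eq, mul_div_assoc]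
  ring_nf

lemma xi01_add_tau_right (τ z : ℂ) :
    xi01 τ (z + τ) = -Complex.exp (-(π * I * (τ + 2 * z))) * xi01 τ z := by
  rw [xi01_eq, add_right_comm, jacobiTheta₂_add_left', xi01_eq, mul_div_assoc, neg_exp_eq]
  congr 1
  rw [Complex.exp_eq_exp_iff_exists_int]
  exact ⟨-1, by push_cast; ring⟩

lemma xi10_add_tau_right (τ z : ℂ) :
    xi10 τ (z + τ) = Complex.exp (-(π * I * (τ + 2 * z))) * xi10 τ z := by
  rw [xi10_eq, add_right_comm, jacobiTheta₂_add_left', xi10_eq, ← mul_assoc, ← Complex.exp_add,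
    ← mul_div_assoc, ← mul_assoc, ← Complex.exp_add]
  ring_nf

lemma continuousAt_xi00 {τ : ℂ} (hτ : 0 < τ.im) (z : ℂ) :
    ContinuousAt (fun p : ℂ × ℂ => xi00 p.1 p.2) (τ, z) := by
  simp only [xi00_eq]
  exact (continuousAt_jacobiTheta₂_comp hτ continuousAt_snd).div
    (continuousAt_jacobiTheta₂_comp (z := z) hτ continuousAt_const) (jacobiTheta₂_zero_ne_zero hτ)

lemma continuousAt_xi01 {τ : ℂ} (hτ : 0 < τ.im) (z : ℂ) :
    ContinuousAt (fun p : ℂ × ℂ => xi01 p.1 p.2) (τ, z) := by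
  simp only [xi01_eq]
  exact (continuousAt_jacobiTheta₂_comp hτ (continuousAt_snd.add_const _)).div
    (continuousAt_jacobiTheta₂_comp (z := z) hτ continuousAt_const)
    (jacobiTheta₂_one_half_ne_zero hτ)

lemma continuousAt_xi10 {τ : ℂ} (hτ : 0 < τ.im) (z : ℂ) :
    ContinuousAt (fun p : ℂ × ℂ => xi10 p.1 p.2) (τ, z) := by
  simp only [xi10_eq]
  refine (ContinuousAt.mul (by fun_prop) (continuousAt_jacobiTheta₂_comp hτ
    (f := fun p => p.2 + p.1 / 2) (by fun_prop))).div
    (continuousAt_jacobiTheta₂_comp (z := z) hτ (f := fun p => p.1 / 2) (by fun_prop))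
    (jacobiTheta₂_half_ne_zero hτ)

lemma differentiableAt_xi00_fst {τ : ℂ} (hτ : 0 < τ.im) (z : ℂ) :
    DifferentiableAt ℂ (fun t => xi00 t z) τ := by
  simp only [xi00_eq]
  exact (differentiableAt_jacobiTheta₂_comp hτ (f := fun _ => z) (by fun_prop)).div
    (differentiableAt_jacobiTheta₂_comp hτ (f := fun _ => 0) (by fun_prop))
    (jacobiTheta₂_zero_ne_zero hτ)

lemma differentiableAt_xi01_fst {τ : ℂ} (hτ : 0 < τ.im) (z : ℂ) :
    DifferentiableAt ℂ (fun t => xi01 t z) τ := by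
  simp only [xi01_eq]
  exact (differentiableAt_jacobiTheta₂_comp hτ (f := fun _ => z + 1 / 2) (by fun_prop)).div
    (differentiableAt_jacobiTheta₂_comp hτ (f := fun _ => 1 / 2) (by fun_prop))
    (jacobiTheta₂_one_half_ne_zero hτ)

lemma differentiableAt_xi10_fst {τ : ℂ} (hτ : 0 < τ.im) (z : ℂ) :
    DifferentiableAt ℂ (fun t => xi10 t z) τ := by
  simp only [xi10_eq]
  exact ((differentiableAt_jacobiTheta₂_comp hτ (f := fun t => z + t / 2)
    (by fun_prop)).const_mul _).div
    (differentiableAt_jacobiTheta₂_comp hτ (f := fun t => t / 2) (by fun_prop))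
    (jacobiTheta₂_half_ne_zero hτ)

lemma differentiable_xi00 {τ : ℂ} (hτ : 0 < τ.im) : Differentiable ℂ (xi00 τ) := by
  rw [funext (xi00_eq τ)]
  exact (differentiable_jacobiTheta₂_comp hτ differentiable_id).div_const _

lemma differentiable_xi01 {τ : ℂ} (hτ : 0 < τ.im) : Differentiable ℂ (xi01 τ) := by
  rw [funext (xi01_eq τ)]
  exact (differentiable_jacobiTheta₂_comp hτ (differentiable_id.add_const _)).div_const _

lemma differentiable_xi10 {τ : ℂ} (hτ : 0 < τ.im) : Differentiable ℂ (xi10 τ) := by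
  rw [funext (xi10_eq τ)]
  exact (Differentiable.mul (by fun_prop)
    (differentiable_jacobiTheta₂_comp hτ (differentiable_id.add_const _))).div_const _

lemma tendsto_xi00 (z : ℂ) :
    Tendsto (fun p : ℂ × ℂ => xi00 p.1 p.2) (imInf ×ˢ 𝓝 z) (𝓝 1) := by
  have h0 := (tendsto_jacobiTheta₂ 0).comp
    ((tendsto_fst (f := imInf) (g := 𝓝 z)).prodMk (tendsto_const_nhds (x := (0 : ℂ))))
  have h := (tendsto_jacobiTheta₂ z).div h0 one_ne_zero
  simp only [xi00_eq]
  rw [div_one] at h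
  exact h

lemma tendsto_xi01 (z : ℂ) :
    Tendsto (fun p : ℂ × ℂ => xi01 p.1 p.2) (imInf ×ˢ 𝓝 z) (𝓝 1) := by
  have h0 := (tendsto_jacobiTheta₂ (1 / 2)).comp
    ((tendsto_fst (f := imInf) (g := 𝓝 z)).prodMk (tendsto_const_nhds (x := (1 / 2 : ℂ))))
  have h1 := (tendsto_jacobiTheta₂ (z + 1 / 2)).comp
    ((tendsto_fst (f := imInf) (g := 𝓝 z)).prodMk (tendsto_snd.add_const (1 / 2 : ℂ)))
  have h := h1.div h0 one_ne_zero
  simp only [xi01_eq]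
  rw [div_one] at h
  exact h

/-- The limit of `xi10` at `i∞`. -/
def cosTerm (z : ℂ) : ℂ := (Complex.exp (π * I * z) + Complex.exp (-(π * I * z))) / 2

lemma tendsto_xi10 (z : ℂ) :
    Tendsto (fun p : ℂ × ℂ => xi10 p.1 p.2) (imInf ×ˢ 𝓝 z) (𝓝 (cosTerm z)) := by
  have h0 := (tendsto_jacobiTheta₂_add_half 0).comp
    ((tendsto_fst (f := imInf) (g := 𝓝 z)).prodMk (tendsto_const_nhds (x := (0 : ℂ))))
  have h2 : Tendsto (fun p : ℂ × ℂ => Complex.exp (π * I * p.2)) (imInf ×ˢ 𝓝 z)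
      (𝓝 (Complex.exp (π * I * z))) :=
    ((show Continuous fun w : ℂ => Complex.exp (π * I * w) by fun_prop).tendsto z).comp tendsto_snd
  have h := (h2.mul (tendsto_jacobiTheta₂_add_half z)).div h0 (by simp [e2_zero])
  have h3 : Complex.exp (π * I * z) * (1 + e2 (-z)) / (1 + e2 (-0)) = cosTerm z := by
    rw [neg_zero, e2_zero, mul_add, e2, ← Complex.exp_add, cosTerm]
    ring_nf
  rw [h3] at h
  refine h.congr fun p => ?_
  rw [xi10_eq]
  simp

lemma jacobiLike_phi01 : JacobiLike 0 1 phi01 fun z => 4 * (2 + cosTerm z ^ 2) := by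
  have hpi : π ≠ 0 := by exact_mod_cast Real.pi_ne_zero
  refine ⟨fun τ z hτ => ?_, fun τ z hτ => ?_, fun τ z hτ => ?_, fun τ z hτ => ?_, fun τ z hτ => ?_,
    fun τ z hτ => ?_, fun τ z hτ => ?_, fun z => ?_⟩
  · exact ((((continuousAt_xi00 hτ z).pow 2).add ((continuousAt_xi01 hτ z).pow 2)).add
      ((continuousAt_xi10 hτ z).pow 2)).const_mul 4
  · exact ((((differentiableAt_xi00_fst hτ z).pow 2).add
      ((differentiableAt_xi01_fst hτ z).pow 2)).add
      ((differentiableAt_xi10_fst hτ z).pow 2)).const_mul 4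
  · exact ((((differentiable_xi00 hτ z).pow 2).add ((differentiable_xi01 hτ z).pow 2)).add
      ((differentiable_xi10 hτ z).pow 2)).const_mul 4
  · rw [phi01, xi00_add_one, xi01_add_one, xi10_add_one, phi01]
    ring
  · have h4 : e2 ((1 : ℤ) * z ^ 2 / τ) = Complex.exp (π * I * z ^ 2 / τ) ^ 2 := by
      rw [exp_sq_eq_e2]
      congr 1
      push_cast
      field_simp
    rw [phi01, xi00_inv hτ, xi01_inv hτ, xi10_inv hτ, h4, phi01, zpow_zero]
    ring
  · rw [phi01, xi00_add_one_right, xi01_add_one_right, xi10_add_one_right, phi01]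
    ring
  · have h4 : e2 (-(1 : ℤ) * (τ + 2 * z)) = Complex.exp (-(π * I * (τ + 2 * z))) ^ 2 := by
      rw [exp_sq_eq_e2]
      congr 1
      push_cast
      field_simp
    rw [phi01, xi00_add_tau_right, xi01_add_tau_right, xi10_add_tau_right, h4, phi01]
    ring
  · have := ((((tendsto_xi00 z).pow 2).add ((tendsto_xi01 z).pow 2)).add
      ((tendsto_xi10 z).pow 2)).const_mul 4
    rwa [one_pow, one_add_one_eq_two] at this

lemma jacobiLike_phi02 : JacobiLike 0 2 phi02 fun z => 2 * (2 + cosTerm (2 * z)) := by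
  have hd : Differentiable ℂ fun z : ℂ => 2 * z := by fun_prop
  have hc : ∀ τ z : ℂ, ContinuousAt (fun p : ℂ × ℂ => (p.1, 2 * p.2)) (τ, z) := fun τ z => by
    fun_prop
  refine ⟨fun τ z hτ => ?_, fun τ z hτ => ?_, fun τ z hτ => ?_, fun τ z hτ => ?_, fun τ z hτ => ?_,
    fun τ z hτ => ?_, fun τ z hτ => ?_, fun z => ?_⟩
  · have h0 := (continuousAt_xi00 hτ (2 * z)).comp (x := (τ, z)) (f := fun p => (p.1, 2 * p.2))
      (hc τ z)
    have h1 := (continuousAt_xi01 hτ (2 * z)).comp (x := (τ, z)) (f := fun p => (p.1, 2 * p.2))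
      (hc τ z)
    have h2 := (continuousAt_xi10 hτ (2 * z)).comp (x := (τ, z)) (f := fun p => (p.1, 2 * p.2))
      (hc τ z)
    exact ((h0.add h1).add h2).const_mul 2
  · exact (((differentiableAt_xi00_fst hτ _).add
      (differentiableAt_xi01_fst hτ _)).add (differentiableAt_xi10_fst hτ _)).const_mul 2
  · exact ((((differentiable_xi00 hτ).comp hd z).add ((differentiable_xi01 hτ).comp hd z)).add
      ((differentiable_xi10 hτ).comp hd z)).const_mul 2
  · rw [phi02, xi00_add_one, xi01_add_one, xi10_add_one, phi02]
    ring
  · have h4 : e2 ((2 : ℤ) * z ^ 2 / τ) = Complex.exp (π * I * (2 * z) ^ 2 / τ) := by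
      rw [e2]
      push_cast
      ring_nf
    rw [phi02, ← mul_div_assoc, xi00_inv hτ, xi01_inv hτ, xi10_inv hτ, h4, phi02, zpow_zero]
    ring
  · have h : 2 * (z + 1) = 2 * z + 1 + 1 := by ring
    rw [phi02, h]
    simp only [xi00_add_one_right, xi01_add_one_right, xi10_add_one_right]
    rw [neg_neg, phi02]
  · have h : 2 * (z + τ) = 2 * z + τ + τ := by ring
    have h4 : e2 (-(2 : ℤ) * (τ + 2 * z)) = Complex.exp (-(π * I * (τ + 2 * (2 * z + τ)))) *
        Complex.exp (-(π * I * (τ + 2 * (2 * z)))) := by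
      rw [e2, ← Complex.exp_add]
      push_cast
      ring_nf
    rw [phi02, h]
    simp only [xi00_add_tau_right, xi01_add_tau_right, xi10_add_tau_right]
    rw [h4, phi02]
    ring
  · have h1 : Tendsto (fun p : ℂ × ℂ => (p.1, 2 * p.2)) (imInf ×ˢ 𝓝 z)
        (imInf ×ˢ 𝓝 (2 * z)) :=
      tendsto_fst.prodMk (tendsto_snd.const_mul _)
    have := ((((tendsto_xi00 (2 * z)).comp h1).add ((tendsto_xi01 (2 * z)).comp h1)).add
      ((tendsto_xi10 (2 * z)).comp h1)).const_mul 2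
    rwa [one_add_one_eq_two] at this

end EvenTheta

section Eisenstein

open Filter Metric
open scoped Topology

variable {k : ℕ}

lemma Eis_coe (hk : 3 ≤ k) (hk2 : Even k) (τ : UpperHalfPlane) :
    Eis k τ = ModularForm.E hk τ := by
  rw [EisensteinSeries.q_expansion_bernoulli hk hk2]
  simp_rw [zpow_natCast]
  rw [tsum_pnat_eq_tsum_succ (f := fun n =>
    (ArithmeticFunction.sigma (k - 1) n : ℂ) * cexp (2 * Real.pi * I * τ) ^ n)]
  simp only [Eis, sigma', qC, e2, ArithmeticFunction.sigma_apply]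

lemma Eis_eq (hk : 3 ≤ k) (hk2 : Even k) {τ : ℂ} (hτ : 0 < τ.im) :
    Eis k τ = ModularForm.E hk ⟨τ, hτ⟩ :=
  Eis_coe hk hk2 ⟨τ, hτ⟩

lemma Eis_add_one (τ : ℂ) : Eis k (τ + 1) = Eis k τ := by
  rw [Eis, qC, e2_add, e2_one, mul_one, Eis, qC]

lemma Eis_inv (hk : 3 ≤ k) (hk2 : Even k) {τ : ℂ} (hτ : 0 < τ.im) :
    Eis k (-1 / τ) = τ ^ (k : ℤ) * Eis k τ := by
  have h := SlashInvariantForm.slash_action_eqn (ModularForm.E hk)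
    (Matrix.SpecialLinearGroup.mapGL ℝ ModularGroup.S) (MonoidHom.mem_range.2 ⟨_, rfl⟩)
  have h2 := (SlashInvariantForm.slash_S_apply (ModularForm.E hk) k ⟨τ, hτ⟩).symm.trans
    (congrFun h ⟨τ, hτ⟩)
  have h3 : (-τ)⁻¹ = -1 / τ := by rw [neg_div, one_div, inv_neg]
  have h4 : Eis k (-τ)⁻¹ = ModularForm.E hk
      (.mk (-τ)⁻¹ (UpperHalfPlane.im_inv_neg_coe_pos ⟨τ, hτ⟩)) :=
    Eis_coe hk hk2 (.mk (-τ)⁻¹ (UpperHalfPlane.im_inv_neg_coe_pos ⟨τ, hτ⟩))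
  rw [← h3, Eis_eq hk hk2 hτ, ← h2, h4, mul_left_comm, ← zpow_add₀ (ne_zero_of_im_pos hτ),
    add_neg_cancel, zpow_zero, mul_one]

lemma differentiableAt_Eis (hk : 3 ≤ k) (hk2 : Even k) {τ : ℂ} (hτ : 0 < τ.im) :
    DifferentiableAt ℂ (Eis k) τ := by
  have h := UpperHalfPlane.mdifferentiable_iff.1 (ModularFormClass.holo (ModularForm.E hk))
  refine ((h τ hτ).differentiableAt (isOpen_im_pos.mem_nhds hτ)).congr_of_eventuallyEq ?_
  filter_upwards [isOpen_im_pos.mem_nhds hτ] with t ht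
  rw [Eis_eq hk hk2 ht, Function.comp_apply, UpperHalfPlane.ofComplex_apply_of_im_pos ht]

lemma tendsto_Eis (hk : 3 ≤ k) (hk2 : Even k) : Tendsto (Eis k) imInf (𝓝 1) := by
  have h1 := (ModularFormClass.analyticAt_cuspFunction_zero (h := 1) (ModularForm.E hk) one_pos
    (by simp)).continuousAt.tendsto
  have h2 : UpperHalfPlane.cuspFunction 1 (ModularForm.E hk) 0 = 1 := by
    rw [← EisensteinSeries.E_qExpansion_coeff_zero hk hk2, UpperHalfPlane.qExpansion_coeff]
    simp
  rw [h2] at h1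
  have h3 := h1.comp ((Function.Periodic.qParam_tendsto one_pos).mono_right nhdsWithin_le_nhds)
  refine Tendsto.congr' ?_ h3
  filter_upwards [eventually_imInf_gt 0] with τ hτ
  rw [Function.comp_apply, Eis_eq hk hk2 hτ]
  exact SlashInvariantFormClass.eq_cuspFunction (h := 1) (ModularForm.E hk) ⟨τ, hτ⟩
    (by simp) one_ne_zero

lemma jacobiLike_Eis (hk : 3 ≤ k) (hk2 : Even k) :
    JacobiLike k 0 (fun τ _ => Eis k τ) fun _ => 1 := by
  refine ⟨fun τ z hτ => ?_, fun τ z hτ => differentiableAt_Eis hk hk2 hτ,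
    fun τ z hτ => differentiableAt_const _, fun τ z hτ => Eis_add_one τ, fun τ z hτ => ?_,
    fun τ z hτ => rfl, fun τ z hτ => ?_, fun z => (tendsto_Eis hk hk2).comp tendsto_fst⟩
  · exact ContinuousAt.comp (x := (τ, z)) (f := fun p : ℂ × ℂ => p.1) (g := Eis k)
      (differentiableAt_Eis hk hk2 hτ).continuousAt continuousAt_fst
  · rw [Eis_inv hk hk2 hτ]
    simp [e2_zero]
  · simp [e2_zero]

end Eisenstein

section JacobiEisensteinAlgebra

open Filter Metric
open scoped Topology

lemma e2_add_int (x : ℂ) (n : ℤ) : e2 (x + n) = e2 x := by rw [e2_add, e2_int, mul_one]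

lemma linear_ne_zero {τ : ℂ} (hτ : 0 < τ.im) {a b c d : ℤ} (h : a * d - b * c = 1) :
    (c * τ + d : ℂ) ≠ 0 := by
  intro h0
  have him := congrArg im h0
  simp [hτ.ne'] at him
  subst him
  have hd : d = 0 := by simpa using h0
  subst hd
  simp at h

lemma exists_det_eq_one {c d : ℤ} (h : IsCoprime c d) : ∃ a b : ℤ, a * d - b * c = 1 := by
  obtain ⟨a, b, hab⟩ := h
  exact ⟨b, -a, by linear_combination hab⟩

lemma isCoprime_of_det_eq_one {a b c d : ℤ} (h : a * d - b * c = 1) : IsCoprime c d :=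
  ⟨-b, a, by linear_combination h⟩

lemma bezout_spec {c d : ℤ} (h : IsCoprime c d) : (bezout c d).1 * d - (bezout c d).2 * c = 1 := by
  have h' : ∃ ab : ℤ × ℤ, ab.1 * d - ab.2 * c = 1 := by
    obtain ⟨a, b, hab⟩ := exists_det_eq_one h
    exact ⟨(a, b), hab⟩
  rw [bezout, dif_pos h']
  exact h'.choose_spec

/-- The summand of the Jacobi–Eisenstein series attached to a matrix `(a b; c d)`. -/
def jacobiSummand (k m : ℕ) (τ z : ℂ) (a b c d : ℤ) : ℂ :=
  ((c : ℂ) * τ + d) ^ (-(k : ℤ)) *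
    ∑' l : ℤ, e2 (m * (l ^ 2 * (a * τ + b) / (c * τ + d) + 2 * l * z / (c * τ + d) -
      c * z ^ 2 / (c * τ + d)))

variable {k m : ℕ} {τ z : ℂ} {a b c d : ℤ}

lemma EisJSummand_eq (hτ : 0 < τ.im) (h : a * d - b * c = 1) :
    EisJSummand k m τ z c d = jacobiSummand k m τ z a b c d := by
  have h' := bezout_spec (isCoprime_of_det_eq_one h)
  have hj := linear_ne_zero hτ h
  rw [EisJSummand]
  generalize (bezout c d).1 = a' at h'
  generalize (bezout c d).2 = b' at h'
  rw [jacobiSummand]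
  congr 1
  refine tsum_congr fun l => ?_
  have ha : a' = a + (b' * a - a' * b) * c := by linear_combination (-a') * h + a * h'
  have hb : b' = b + (b' * a - a' * b) * d := by linear_combination (-b') * h + b * h'
  rw [← e2_add_int _ (m * l ^ 2 * (a' * b - b' * a))]
  congr 1
  have ha' : (a' : ℂ) = a + (b' * a - a' * b) * c := by exact_mod_cast ha
  have hb' : (b' : ℂ) = b + (b' * a - a' * b) * d := by exact_mod_cast hb
  have key : (a' * τ + b' : ℂ) = (a * τ + b) + (b' * a - a' * b) * (c * τ + d) := by
    linear_combination τ * ha' + hb'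
  rw [key]
  push_cast
  generalize (c * τ + d : ℂ) = j at hj
  field_simp
  ring

lemma jacobiSummand_eq_theta (k m : ℕ) (τ z : ℂ) (a b c d : ℤ) :
    jacobiSummand k m τ z a b c d = ((c : ℂ) * τ + d) ^ (-(k : ℤ)) *
      (e2 (-(m * (c * z ^ 2 / (c * τ + d)))) *
        jacobiTheta₂ (2 * m * (z / (c * τ + d))) (2 * m * ((a * τ + b) / (c * τ + d)))) := by
  rw [jacobiSummand, jacobiTheta₂, ← tsum_mul_left (a := e2 _)]
  congr 1
  refine tsum_congr fun l => ?_
  rw [jacobiTheta₂_term, e2, e2, ← Complex.exp_add]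
  congr 1
  ring

lemma EisJSummand_add_one (hτ : 0 < τ.im) (h : IsCoprime c d) :
    EisJSummand k m (τ + 1) z c d = EisJSummand k m τ z c (c + d) := by
  obtain ⟨a, b, hab⟩ := exists_det_eq_one h
  have hτ' : 0 < (τ + 1).im := by simpa using hτ
  have h' : a * (c + d) - (a + b) * c = 1 := by linear_combination hab
  rw [EisJSummand_eq hτ' hab, EisJSummand_eq hτ h', jacobiSummand, jacobiSummand]
  push_cast
  have e1 : (c * (τ + 1) + d : ℂ) = c * τ + (c + d) := by ring
  have e2 : (a * (τ + 1) + b : ℂ) = a * τ + (a + b) := by ring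
  rw [e1, e2]

lemma EisJSummand_inv (hτ : 0 < τ.im) (h : IsCoprime c d) :
    EisJSummand k m (-1 / τ) (z / τ) c d =
      τ ^ (k : ℤ) * e2 (m * z ^ 2 / τ) * EisJSummand k m τ z d (-c) := by
  obtain ⟨a, b, hab⟩ := exists_det_eq_one h
  have hτ0 := ne_zero_of_im_pos hτ
  have h' : b * (-c) - (-a) * d = 1 := by linear_combination hab
  have hj := linear_ne_zero hτ h'
  rw [EisJSummand_eq (im_neg_one_div_pos hτ) hab, EisJSummand_eq hτ h', jacobiSummand,
    jacobiSummand, mul_mul_mul_comm, ← tsum_mul_left (a := e2 _)]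
  have e1 : (c * (-1 / τ) + d : ℂ) = (d * τ + (-c : ℤ)) / τ := by
    push_cast
    field_simp
    ring
  have e3 : (a * (-1 / τ) + b : ℂ) = (b * τ + (-a : ℤ)) / τ := by
    push_cast
    field_simp
    ring
  rw [e1, e3, div_zpow, zpow_neg τ, div_inv_eq_mul, mul_comm (_ ^ _) (τ ^ _)]
  congr 1
  refine tsum_congr fun l => ?_
  rw [← e2_add]
  congr 1
  have e4 : (c : ℂ) = d * τ - (d * τ + (-c : ℤ)) := by push_cast; ring
  rw [e4]
  generalize (d * τ + (-c : ℤ) : ℂ) = j at hj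
  field_simp
  ring

lemma jacobiSummand_add_one_right (hτ : 0 < τ.im) (h : a * d - b * c = 1) :
    jacobiSummand k m τ (z + 1) a b c d = jacobiSummand k m τ z a b c d := by
  have hj := linear_ne_zero hτ h
  have hC : (a * d - b * c : ℂ) = 1 := by exact_mod_cast h
  rw [jacobiSummand, jacobiSummand]
  congr 1
  rw [← (Equiv.addRight c).tsum_eq]
  refine tsum_congr fun l => ?_
  rw [Equiv.coe_addRight, ← e2_add_int _ (-(m * (2 * l * a + c * a)))]
  congr 1
  push_cast
  field_simp
  linear_combination (-(m * (2 * l + c)) : ℂ) * hC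

lemma jacobiSummand_add_tau_right (hτ : 0 < τ.im) (h : a * d - b * c = 1) :
    jacobiSummand k m τ (z + τ) a b c d =
      e2 (-m * (τ + 2 * z)) * jacobiSummand k m τ z a b c d := by
  have hj := linear_ne_zero hτ h
  have hC : (a * d - b * c : ℂ) = 1 := by exact_mod_cast h
  rw [jacobiSummand, jacobiSummand, mul_left_comm, ← tsum_mul_left (a := e2 _)]
  congr 1
  rw [← (Equiv.subRight d).tsum_eq]
  refine tsum_congr fun l => ?_
  rw [Equiv.subRight_apply, ← e2_add, ← e2_add_int (_ + _) (m * (b * d - 2 * l * b))]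
  congr 1
  obtain ⟨j, hj'⟩ : ∃ j : ℂ, j = c * τ + d := ⟨_, rfl⟩
  rw [← hj'] at hj ⊢
  push_cast
  field_simp
  linear_combination (m * τ * (d - 2 * l) : ℂ) * hC + m * (τ + 2 * z - d * b + 2 * l * b) * hj'

lemma EisJ_add_one (hτ : 0 < τ.im) : EisJ k m (τ + 1) z = EisJ k m τ z := by
  let e : {p : ℤ × ℤ // IsCoprime p.1 p.2} ≃ {p : ℤ × ℤ // IsCoprime p.1 p.2} :=
    { toFun := fun p => ⟨(p.1.1, p.1.1 + p.1.2), by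
        obtain ⟨a, b, h⟩ := p.2
        exact ⟨a - b, b, by linear_combination h⟩⟩
      invFun := fun p => ⟨(p.1.1, p.1.2 - p.1.1), by
        obtain ⟨a, b, h⟩ := p.2
        exact ⟨a + b, b, by linear_combination h⟩⟩
      left_inv := fun p => by simp
      right_inv := fun p => by simp }
  rw [EisJ, EisJ, ← e.tsum_eq fun p => EisJSummand k m τ z p.1.1 p.1.2]
  congr 1
  exact tsum_congr fun p => EisJSummand_add_one hτ p.2

lemma EisJ_inv (hτ : 0 < τ.im) :
    EisJ k m (-1 / τ) (z / τ) = τ ^ (k : ℤ) * e2 (m * z ^ 2 / τ) * EisJ k m τ z := by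
  let e : {p : ℤ × ℤ // IsCoprime p.1 p.2} ≃ {p : ℤ × ℤ // IsCoprime p.1 p.2} :=
    { toFun := fun p => ⟨(p.1.2, -p.1.1), p.2.symm.neg_right⟩
      invFun := fun p => ⟨(-p.1.2, p.1.1), p.2.symm.neg_left⟩
      left_inv := fun p => by simp
      right_inv := fun p => by simp }
  rw [EisJ, EisJ, ← e.tsum_eq fun p => EisJSummand k m τ z p.1.1 p.1.2, mul_left_comm]
  congr 1
  rw [← tsum_mul_left]
  exact tsum_congr fun p => EisJSummand_inv hτ p.2

lemma EisJ_add_one_right (hτ : 0 < τ.im) : EisJ k m τ (z + 1) = EisJ k m τ z := by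
  rw [EisJ, EisJ]
  congr 1
  refine tsum_congr fun p => ?_
  obtain ⟨a, b, hab⟩ := exists_det_eq_one p.2
  rw [EisJSummand_eq hτ hab, EisJSummand_eq hτ hab, jacobiSummand_add_one_right hτ hab]

lemma EisJ_add_tau_right (hτ : 0 < τ.im) :
    EisJ k m τ (z + τ) = e2 (-m * (τ + 2 * z)) * EisJ k m τ z := by
  rw [EisJ, EisJ, mul_left_comm]
  congr 1
  rw [← tsum_mul_left]
  refine tsum_congr fun p => ?_
  obtain ⟨a, b, hab⟩ := exists_det_eq_one p.2
  rw [EisJSummand_eq hτ hab, EisJSummand_eq hτ hab, jacobiSummand_add_tau_right hτ hab]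

end JacobiEisensteinAlgebra

section JacobiEisensteinBound

open Filter Metric
open scoped Topology

variable {k m : ℕ} {τ z : ℂ} {a b c d : ℤ}

lemma im_moebius (h : a * d - b * c = 1) :
    ((a * τ + b : ℂ) / (c * τ + d)).im = τ.im / ‖(c * τ + d : ℂ)‖ ^ 2 := by
  have hC : (a * d - b * c : ℝ) = 1 := by exact_mod_cast h
  rw [div_im, ← normSq_eq_norm_sq, ← sub_div]
  congr 1
  simp
  linear_combination τ.im * hC

lemma norm_e2_jacobiSummand (hτ : 0 < τ.im) (h : a * d - b * c = 1) (m : ℕ) (z : ℂ) :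
    ∃ s : ℝ, ∀ l : ℤ, ‖e2 (m * (l ^ 2 * (a * τ + b) / (c * τ + d) + 2 * l * z / (c * τ + d) -
      c * z ^ 2 / (c * τ + d)))‖ = Real.exp (2 * Real.pi * m * (z.im ^ 2 / τ.im)) *
        Real.exp (-(2 * Real.pi * m * (τ.im / ‖(c * τ + d : ℂ)‖ ^ 2)) * (l + s) ^ 2) := by
  have hj := linear_ne_zero hτ h
  have hC : (a * d - b * c : ℂ) = 1 := by exact_mod_cast h
  obtain ⟨p, hp⟩ : ∃ p : ℝ, p = z.im / τ.im := ⟨_, rfl⟩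
  obtain ⟨r, hr⟩ : ∃ r : ℝ, r = z.re - p * τ.re := ⟨_, rfl⟩
  have hpτ : p * τ.im = z.im := by rw [hp]; field_simp
  have hz : z = p * τ + r := by
    apply Complex.ext
    · simp [hr]
    · simp [hpτ]
  refine ⟨p * d - r * c, fun l => ?_⟩
  have hw : z / (c * τ + d) = (p * d - r * c) * ((a * τ + b) / (c * τ + d)) + (r * a - p * b) := by
    rw [div_eq_iff hj, add_mul, mul_assoc, div_mul_cancel₀ _ hj]
    linear_combination hz - (p * τ + r) * hC
  have hcz : c * z ^ 2 / (c * τ + d) = p * z - (p * d - r * c) * (z / (c * τ + d)) := by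
    have : (p * d - r * c + c * z : ℂ) = p * (c * τ + d) := by linear_combination c * hz
    field_simp
    linear_combination z * this
  have hQ : (l ^ 2 * (a * τ + b) / (c * τ + d) + 2 * l * z / (c * τ + d) -
      c * z ^ 2 / (c * τ + d) : ℂ) =
      (((l + (p * d - r * c)) ^ 2 : ℝ) : ℂ) * ((a * τ + b) / (c * τ + d)) -
        ((p ^ 2 : ℝ) : ℂ) * τ +
        ((2 * l * (r * a - p * b) - p * r + (p * d - r * c) * (r * a - p * b) : ℝ) : ℂ) := by
    rw [hcz, mul_div_assoc, mul_div_assoc, hw]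
    push_cast
    linear_combination (-p : ℂ) * hz
  rw [norm_e2, hQ, ← Real.exp_add, ← ofReal_natCast m, im_ofReal_mul, add_im, sub_im,
    im_ofReal_mul, im_ofReal_mul, ofReal_im, im_moebius h]
  congr 1
  have hv : z.im ^ 2 / τ.im = p ^ 2 * τ.im := by
    rw [← hpτ]
    field_simp
  rw [hv]
  ring

lemma exists_tsum_gaussian_le : ∃ C : ℝ, 0 ≤ C ∧ ∀ (f : ℤ → ℂ) (K α s : ℝ), 0 < α → 0 ≤ K →
    (∀ l : ℤ, ‖f l‖ ≤ K * Real.exp (-α * (l + s) ^ 2)) → ‖∑' l, f l‖ ≤ K * ((1 + 1 / α) * C) := by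
  have hsum : Summable fun l : ℤ => (3 / (1 + l ^ 2) : ℝ) := by
    refine Summable.of_nonneg_of_le (fun l => by positivity) (fun l => ?_)
      (((Real.summable_one_div_int_add_rpow (1 / 2) 2).2 one_lt_two).mul_left 6)
    have h2 : |(l + 1 / 2 : ℝ)| ^ (2 : ℝ) = (l + 1 / 2) ^ 2 := by norm_cast; simp
    have h0 : (l + 1 / 2 : ℝ) ≠ 0 := by
      intro h
      have : (2 * l + 1 : ℝ) = 0 := by linarith
      norm_cast at this
      omega
    rw [h2, mul_one_div, div_le_div_iff₀ (by positivity) (by positivity)]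
    nlinarith [sq_nonneg (l - 1 : ℝ)]
  refine ⟨∑' l : ℤ, (3 / (1 + l ^ 2) : ℝ), tsum_nonneg fun l => by positivity, ?_⟩
  intro f K α s hα hK hf
  have hs := ((Equiv.addRight ⌊s⌋).hasSum_iff.2 hsum.hasSum).mul_left (K * (1 + 1 / α))
  rw [← mul_assoc]
  refine tsum_of_norm_bounded hs fun l => (hf l).trans ?_
  rw [mul_assoc]
  refine mul_le_mul_of_nonneg_left ?_ hK
  simp only [Function.comp_apply, Equiv.coe_addRight, Int.cast_add]
  have hx1 := Int.floor_le s
  have hx2 := Int.lt_floor_add_one s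
  set x : ℝ := l + s
  have h1 : Real.exp (-α * x ^ 2) ≤ (1 + 1 / α) / (1 + x ^ 2) := by
    rw [neg_mul, Real.exp_neg, inv_eq_one_div, div_le_div_iff₀ (Real.exp_pos _) (by positivity)]
    have h3 := Real.add_one_le_exp (α * x ^ 2)
    have h4 : 1 + x ^ 2 ≤ (1 + 1 / α) * (α * x ^ 2 + 1) := by
      have : (1 + 1 / α) * (α * x ^ 2 + 1) = 1 + x ^ 2 + (α * x ^ 2 + 1 / α) := by
        field_simp
        ring
      rw [this]
      have : 0 ≤ α * x ^ 2 + 1 / α := by positivity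
      linarith
    rw [one_mul]
    exact h4.trans (mul_le_mul_of_nonneg_left h3 (by positivity))
  refine h1.trans ?_
  rw [div_eq_mul_one_div]
  refine mul_le_mul_of_nonneg_left ?_ (by positivity)
  rw [div_le_div_iff₀ (by positivity) (by positivity)]
  obtain ⟨y, hy⟩ : ∃ y : ℝ, y = s - ⌊s⌋ := ⟨_, rfl⟩
  have hxy : x = (l + ⌊s⌋ : ℝ) + y := by rw [hy]; simp only [x]; ring
  have hy0 : 0 ≤ y := by linarith
  have hy1 : y ≤ 1 := by linarith
  rw [hxy]
  nlinarith [sq_nonneg ((l + ⌊s⌋ : ℝ) + 2 * y), sq_nonneg (2 * (l + ⌊s⌋ : ℝ) + 3 * y)]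

lemma norm_EisJSummand_le : ∃ C : ℝ, 0 ≤ C ∧ ∀ (k m : ℕ) (τ z : ℂ) (c d : ℤ), 1 ≤ m → 0 < τ.im →
    IsCoprime c d → ‖EisJSummand k m τ z c d‖ ≤ ‖(c * τ + d : ℂ)‖ ^ (-(k : ℤ)) *
      (Real.exp (2 * Real.pi * m * (z.im ^ 2 / τ.im)) *
        ((1 + ‖(c * τ + d : ℂ)‖ ^ 2 / τ.im) * C)) := by
  obtain ⟨C, hC0, hC⟩ := exists_tsum_gaussian_le
  refine ⟨C, hC0, fun k m τ z c d hm hτ hcd => ?_⟩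
  obtain ⟨a, b, hab⟩ := exists_det_eq_one hcd
  have hj := norm_pos_iff.2 (linear_ne_zero hτ hab)
  rw [EisJSummand_eq hτ hab, jacobiSummand, norm_mul, norm_zpow]
  refine mul_le_mul_of_nonneg_left ?_ (by positivity)
  obtain ⟨s, hs⟩ := norm_e2_jacobiSummand hτ hab m z
  have hm' : (1 : ℝ) ≤ m := by exact_mod_cast hm
  have hα : 0 < 2 * Real.pi * m * (τ.im / ‖(c * τ + d : ℂ)‖ ^ 2) := by positivity
  refine (hC _ _ _ s hα (Real.exp_pos _).le fun l => (hs l).le).trans ?_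
  refine mul_le_mul_of_nonneg_left (mul_le_mul_of_nonneg_right ?_ hC0) (Real.exp_pos _).le
  refine add_le_add le_rfl ?_
  rw [div_le_div_iff₀ hα hτ]
  have h1 : (1 : ℝ) ≤ 2 * Real.pi * m := by nlinarith [Real.pi_gt_three]
  have h2 : ‖(c * τ + d : ℂ)‖ ^ 2 * (2 * Real.pi * m * (τ.im / ‖(c * τ + d : ℂ)‖ ^ 2)) =
      2 * Real.pi * m * τ.im := by
    field_simp
  rw [h2]
  exact mul_le_mul_of_nonneg_right h1 hτ.le

lemma exists_summable_bound (hk : 5 ≤ k) (hm : 1 ≤ m) (A B M : ℝ) (hB : 0 < B) :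
    ∃ u : {p : ℤ × ℤ // IsCoprime p.1 p.2} → ℝ, Summable u ∧ ∀ p (τ z : ℂ), |τ.re| ≤ A →
      B ≤ τ.im → |z.im| ≤ M → ‖EisJSummand k m τ z p.1.1 p.1.2‖ ≤ u p := by
  obtain ⟨C, hC0, hC⟩ := norm_EisJSummand_le
  let v : {p : ℤ × ℤ // IsCoprime p.1 p.2} → Fin 2 → ℤ := fun p => ![p.1.1, p.1.2]
  have hv : Function.Injective v := by
    intro p q hpq
    have h0 := congrFun hpq 0
    have h1 := congrFun hpq 1
    simp only [v, Matrix.cons_val_zero, Matrix.cons_val_one] at h0 h1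
    exact Subtype.ext (Prod.ext h0 h1)
  set R := EisensteinSeries.r ⟨⟨A, B⟩, hB⟩
  have hk' : (5 : ℝ) ≤ k := by exact_mod_cast hk
  have hsum : ∀ x : ℝ, 2 < x → Summable fun p => R ^ (-x) * ‖v p‖ ^ (-x) := fun x hx =>
    ((EisensteinSeries.summable_one_div_norm_rpow hx).comp_injective hv).mul_left _
  refine ⟨fun p => Real.exp (2 * Real.pi * m * (M ^ 2 / B)) * C *
    (R ^ (-(k : ℝ)) * ‖v p‖ ^ (-(k : ℝ)) +
      (1 / B) * (R ^ (-((k : ℝ) - 2)) * ‖v p‖ ^ (-((k : ℝ) - 2)))),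
    ((hsum _ (by linarith)).add ((hsum _ (by linarith)).mul_left _)).mul_left _, ?_⟩
  intro p τ z hA hBτ hM
  have hτ : 0 < τ.im := hB.trans_le hBτ
  have hmem : (⟨τ, hτ⟩ : UpperHalfPlane) ∈ UpperHalfPlane.verticalStrip A B := ⟨hA, hBτ⟩
  have hbound : ∀ x : ℝ, 0 ≤ x → ‖(p.1.1 * τ + p.1.2 : ℂ)‖ ^ (-x) ≤ R ^ (-x) * ‖v p‖ ^ (-x) :=
    fun x hx => EisensteinSeries.summand_bound_of_mem_verticalStrip hx (v p) hB hmem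
  obtain ⟨a, b, hab⟩ := exists_det_eq_one p.2
  have hj := norm_pos_iff.2 (linear_ne_zero hτ hab)
  have h1 := hbound k (by linarith)
  have h2 := hbound (k - 2) (by linarith)
  refine (hC k m τ z _ _ hm hτ p.2).trans ?_
  set j := ‖(p.1.1 * τ + p.1.2 : ℂ)‖
  have e1 : j ^ (-(k : ℤ)) = j ^ (-(k : ℝ)) := by
    rw [← Real.rpow_intCast]
    push_cast
    rfl
  have e3 : j ^ (-((k : ℝ) - 2)) = j ^ (-(k : ℝ)) * j ^ 2 := by
    rw [← Real.rpow_natCast j 2, ← Real.rpow_add hj]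
    congr 1
    push_cast
    ring
  have h3 : Real.exp (2 * Real.pi * m * (z.im ^ 2 / τ.im)) ≤
      Real.exp (2 * Real.pi * m * (M ^ 2 / B)) := by
    refine Real.exp_le_exp.2 (mul_le_mul_of_nonneg_left ?_ (by positivity))
    refine div_le_div₀ (sq_nonneg _) ?_ hB hBτ
    exact sq_le_sq' (by linarith [neg_abs_le z.im]) ((le_abs_self _).trans hM)
  have h4 : j ^ (-(k : ℝ)) * (1 + j ^ 2 / τ.im) ≤ R ^ (-(k : ℝ)) * ‖v p‖ ^ (-(k : ℝ)) +
      (1 / B) * (R ^ (-((k : ℝ) - 2)) * ‖v p‖ ^ (-((k : ℝ) - 2))) := by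
    have h5 : j ^ (-(k : ℝ)) * (1 + j ^ 2 / τ.im) =
        j ^ (-(k : ℝ)) + (1 / τ.im) * j ^ (-((k : ℝ) - 2)) := by
      rw [e3]
      ring
    rw [h5]
    refine add_le_add h1 (mul_le_mul ?_ h2 (by positivity) (by positivity))
    exact one_div_le_one_div_of_le hB hBτ
  calc j ^ (-(k : ℤ)) * (Real.exp (2 * Real.pi * m * (z.im ^ 2 / τ.im)) * ((1 + j ^ 2 / τ.im) * C))
      = Real.exp (2 * Real.pi * m * (z.im ^ 2 / τ.im)) * C *
        (j ^ (-(k : ℝ)) * (1 + j ^ 2 / τ.im)) := by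
        rw [e1]
        ring
    _ ≤ _ := mul_le_mul (mul_le_mul_of_nonneg_right h3 hC0) h4 (by positivity) (by positivity)

end JacobiEisensteinBound

section JacobiEisenstein

open Filter Metric
open scoped Topology

variable {k m : ℕ} {τ z : ℂ} {a b c d : ℤ}

lemma differentiableAt_EisJSummand (hm : 1 ≤ m) (hτ : 0 < τ.im) (h : IsCoprime c d) :
    DifferentiableAt ℂ (fun p : ℂ × ℂ => EisJSummand k m p.1 p.2 c d) (τ, z) := by
  have hab := bezout_spec h
  have hj := linear_ne_zero hτ hab
  have hm' : (0 : ℝ) < m := by exact_mod_cast hm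
  have him : 0 < (2 * m * (((bezout c d).1 * τ + (bezout c d).2) / (c * τ + d)) : ℂ).im := by
    have h1 : (2 * m : ℂ) = ((2 * m : ℝ) : ℂ) := by push_cast; rfl
    rw [h1, im_ofReal_mul, im_moebius hab]
    have := norm_pos_iff.2 hj
    positivity
  have heq : (fun p : ℂ × ℂ => EisJSummand k m p.1 p.2 c d) = fun p =>
      ((c : ℂ) * p.1 + d) ^ (-(k : ℤ)) * (e2 (-(m * (c * p.2 ^ 2 / (c * p.1 + d)))) *
        jacobiTheta₂ (2 * m * (p.2 / (c * p.1 + d)))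
          (2 * m * (((bezout c d).1 * p.1 + (bezout c d).2) / (c * p.1 + d)))) :=
    funext fun p => jacobiSummand_eq_theta k m p.1 p.2 _ _ c d
  rw [heq]
  have hlin : ∀ x y : ℂ, DifferentiableAt ℂ (fun p : ℂ × ℂ => x * p.1 + y) (τ, z) := fun x y =>
    (differentiableAt_fst.const_mul x).add_const y
  have hsnd : DifferentiableAt ℂ (fun p : ℂ × ℂ => p.2) (τ, z) := differentiableAt_snd
  have hinv : DifferentiableAt ℂ (fun p : ℂ × ℂ => (c * p.1 + d : ℂ)⁻¹) (τ, z) :=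
    (differentiableAt_inv hj).comp (τ, z) (hlin c d)
  have h1 : DifferentiableAt ℂ (fun p : ℂ × ℂ => 2 * (m : ℂ) * (p.2 / (c * p.1 + d))) (τ, z) := by
    simp only [div_eq_mul_inv]
    exact (hsnd.mul hinv).const_mul _
  have h2 : DifferentiableAt ℂ (fun p : ℂ × ℂ =>
      2 * (m : ℂ) * (((bezout c d).1 * p.1 + (bezout c d).2) / (c * p.1 + d))) (τ, z) := by
    simp only [div_eq_mul_inv]
    exact ((hlin _ _).mul hinv).const_mul _
  have h3 : DifferentiableAt ℂ (fun p : ℂ × ℂ => -(m * (c * p.2 ^ 2 / (c * p.1 + d)))) (τ, z) := by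
    simp only [div_eq_mul_inv]
    exact ((((hsnd.pow 2).const_mul _).mul hinv).const_mul _).neg
  refine ((hlin c d).zpow (Or.inl hj)).mul
    (((differentiable_e2 _).comp (τ, z) h3).mul ?_)
  exact ((hasFDerivAt_jacobiTheta₂ _ him).differentiableAt).comp (τ, z) (h1.prodMk h2)

/-- Locally in both variables, the Jacobi–Eisenstein series is dominated by a convergent series. -/
lemma exists_summable_bound_nhds (hk : 5 ≤ k) (hm : 1 ≤ m) (hτ : 0 < τ.im) (z : ℂ) :
    ∃ (U : Set ℂ) (V : Set ℂ) (u : {p : ℤ × ℤ // IsCoprime p.1 p.2} → ℝ),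
      IsOpen U ∧ IsOpen V ∧ τ ∈ U ∧ z ∈ V ∧ (∀ t ∈ U, 0 < t.im) ∧ Summable u ∧
      ∀ p, ∀ t ∈ U, ∀ w ∈ V, ‖EisJSummand k m t w p.1.1 p.1.2‖ ≤ u p := by
  obtain ⟨u, hu, hb⟩ := exists_summable_bound hk hm (|τ.re| + 1) (τ.im / 2) (|z.im| + 1)
    (by positivity)
  refine ⟨{t | |t.re| < |τ.re| + 1 ∧ τ.im / 2 < t.im}, {w | |w.im| < |z.im| + 1}, u,
    (isOpen_lt continuous_re.abs continuous_const).inter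
      (isOpen_lt continuous_const continuous_im),
    isOpen_lt continuous_im.abs continuous_const, ⟨lt_add_one _, half_lt_self hτ⟩,
    show |z.im| < |z.im| + 1 from lt_add_one _,
    fun t ht => (half_pos hτ).trans ht.2, hu, fun p t ht w hw => ?_⟩
  exact hb p t w ht.1.le ht.2.le (le_of_lt hw)

lemma continuousAt_EisJ (hk : 5 ≤ k) (hm : 1 ≤ m) (hτ : 0 < τ.im) (z : ℂ) :
    ContinuousAt (fun p : ℂ × ℂ => EisJ k m p.1 p.2) (τ, z) := by
  obtain ⟨U, V, u, hU, hV, hτU, hzV, hpos, hu, hb⟩ := exists_summable_bound_nhds hk hm hτ z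
  refine ContinuousAt.mul continuousAt_const ?_
  refine (continuousOn_tsum (s := U ×ˢ V) (fun p x hx => ?_) hu
    fun p x hx => hb p _ hx.1 _ hx.2).continuousAt ((hU.prod hV).mem_nhds ⟨hτU, hzV⟩)
  exact (differentiableAt_EisJSummand hm (hpos _ hx.1) p.2).continuousAt.continuousWithinAt

lemma differentiableAt_EisJ_fst (hk : 5 ≤ k) (hm : 1 ≤ m) (hτ : 0 < τ.im) (z : ℂ) :
    DifferentiableAt ℂ (fun t => EisJ k m t z) τ := by
  obtain ⟨U, V, u, hU, hV, hτU, hzV, hpos, hu, hb⟩ := exists_summable_bound_nhds hk hm hτ z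
  refine DifferentiableAt.const_mul ?_ _
  refine (differentiableOn_tsum_of_summable_norm hu (fun p t ht => ?_) hU
    fun p t ht => hb p t ht z hzV).differentiableAt (hU.mem_nhds hτU)
  exact ((differentiableAt_EisJSummand (z := z) hm (hpos _ ht) p.2).comp
    (f := fun t => (t, z)) t (differentiableAt_id.prodMk
      (differentiableAt_const z))).differentiableWithinAt

lemma differentiableAt_EisJ_snd (hk : 5 ≤ k) (hm : 1 ≤ m) (hτ : 0 < τ.im) (z : ℂ) :
    DifferentiableAt ℂ (EisJ k m τ) z := by
  obtain ⟨U, V, u, hU, hV, hτU, hzV, hpos, hu, hb⟩ := exists_summable_bound_nhds hk hm hτ z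
  refine DifferentiableAt.const_mul ?_ _
  refine (differentiableOn_tsum_of_summable_norm hu (fun p t ht => ?_) hV
    fun p t ht => hb p τ hτU t ht).differentiableAt (hV.mem_nhds hzV)
  exact ((differentiableAt_EisJSummand (z := t) hm hτ p.2).comp
    (f := fun t => (τ, t)) t ((differentiableAt_const τ).prodMk
      differentiableAt_id)).differentiableWithinAt

lemma tendsto_EisJSummand_zero (hm : 1 ≤ m) (hk : Even k) (h : IsCoprime 0 d) (z : ℂ) :
    Tendsto (fun p : ℂ × ℂ => EisJSummand k m p.1 p.2 0 d) (imInf ×ˢ 𝓝 z) (𝓝 1) := by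
  have hd : d = 1 ∨ d = -1 := Int.isUnit_iff.1 (isCoprime_zero_left.1 h)
  have hm' : (0 : ℝ) < m := by exact_mod_cast hm
  have h1 : Tendsto (fun t : ℂ => 2 * (m : ℂ) * t) imInf imInf := by
    have h2 : (2 * m : ℂ) = ((2 * m : ℝ) : ℂ) := by push_cast; rfl
    simp only [imInf, tendsto_comap_iff, Function.comp_def, h2, im_ofReal_mul]
    exact tendsto_comap.const_mul_atTop (by positivity)
  have h2 : Tendsto (fun w : ℂ => 2 * (m : ℂ) * (w * d)) (𝓝 z) (𝓝 (2 * m * (z * d))) :=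
    (by fun_prop : Continuous fun w : ℂ => 2 * (m : ℂ) * (w * d)).tendsto z
  refine ((tendsto_jacobiTheta₂ (2 * m * (z * d))).comp (h1.prodMap h2)).congr' ?_
  filter_upwards [tendsto_fst.eventually (eventually_imInf_gt 0)] with p hp
  have hdd : d * d - 0 * 0 = 1 := by rcases hd with rfl | rfl <;> norm_num
  rw [EisJSummand_eq hp hdd, jacobiSummand_eq_theta]
  rcases hd with rfl | rfl <;> simp [e2_zero, hk.neg_one_pow, Function.comp, div_neg]

lemma tendsto_EisJSummand_of_ne_zero (hm : 1 ≤ m) (hk : 5 ≤ k) (h : IsCoprime c d) (hc : c ≠ 0)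
    (z : ℂ) : Tendsto (fun p : ℂ × ℂ => EisJSummand k m p.1 p.2 c d) (imInf ×ˢ 𝓝 z) (𝓝 0) := by
  obtain ⟨C, hC0, hC⟩ := norm_EisJSummand_le
  set K := Real.exp (2 * Real.pi * m * (|z.im| + 1) ^ 2) * (2 * C) with hK
  have hlim : Tendsto (fun p : ℂ × ℂ => K * (p.1.im)⁻¹) (imInf ×ˢ 𝓝 z) (𝓝 0) := by
    have h1 : Tendsto (fun t : ℂ => (t.im)⁻¹) imInf (𝓝 0) :=
      tendsto_inv_atTop_zero.comp tendsto_comap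
    simpa using (h1.comp tendsto_fst).const_mul K
  refine squeeze_zero_norm' ?_ hlim
  have hz : ∀ᶠ w in 𝓝 z, |w.im| < |z.im| + 1 :=
    (isOpen_lt continuous_im.abs continuous_const).mem_nhds (lt_add_one |z.im|)
  filter_upwards [tendsto_fst.eventually (eventually_imInf_gt 1), tendsto_snd.eventually hz]
    with p hp1 hp2
  have hp0 : 0 < p.1.im := one_pos.trans hp1
  refine (hC k m p.1 p.2 c d hm hp0 h).trans ?_
  have hj : p.1.im ≤ ‖(c * p.1 + d : ℂ)‖ := by
    have h1 : |c * p.1.im| ≤ ‖(c * p.1 + d : ℂ)‖ := by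
      simpa using abs_im_le_norm (c * p.1 + d : ℂ)
    have h2 : (1 : ℝ) ≤ |(c : ℝ)| := by exact_mod_cast Int.one_le_abs hc
    rw [abs_mul, abs_of_pos hp0] at h1
    nlinarith
  set j := ‖(c * p.1 + d : ℂ)‖
  have hj1 : 1 ≤ j := hp1.le.trans hj
  have hj0 : 0 < j := one_pos.trans_le hj1
  have h1 : Real.exp (2 * Real.pi * m * (p.2.im ^ 2 / p.1.im)) ≤
      Real.exp (2 * Real.pi * m * (|z.im| + 1) ^ 2) := by
    refine Real.exp_le_exp.2 (mul_le_mul_of_nonneg_left ?_ (by positivity))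
    refine (div_le_self (sq_nonneg _) hp1.le).trans ?_
    exact sq_le_sq' (by linarith [neg_abs_le p.2.im]) ((le_abs_self _).trans hp2.le)
  have h2 : j ^ (-(k : ℤ)) * (1 + j ^ 2 / p.1.im) ≤ 2 * (p.1.im)⁻¹ := by
    have h3 : 1 + j ^ 2 / p.1.im ≤ 2 * j ^ 2 := by
      have : j ^ 2 / p.1.im ≤ j ^ 2 := div_le_self (sq_nonneg _) hp1.le
      nlinarith
    have h4 : j ^ (-(k : ℤ)) ≤ j ^ (-3 : ℤ) := zpow_le_zpow_right₀ hj1 (by omega)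
    calc j ^ (-(k : ℤ)) * (1 + j ^ 2 / p.1.im) ≤ j ^ (-3 : ℤ) * (2 * j ^ 2) :=
          mul_le_mul h4 h3 (by positivity) (by positivity)
      _ = 2 * j⁻¹ := by
          rw [zpow_neg]
          norm_cast
          field_simp
      _ ≤ _ := mul_le_mul_of_nonneg_left (inv_anti₀ hp0 hj) zero_le_two
  calc j ^ (-(k : ℤ)) * (Real.exp (2 * Real.pi * m * (p.2.im ^ 2 / p.1.im)) *
        ((1 + j ^ 2 / p.1.im) * C))
      = Real.exp (2 * Real.pi * m * (p.2.im ^ 2 / p.1.im)) * C *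
        (j ^ (-(k : ℤ)) * (1 + j ^ 2 / p.1.im)) := by ring
    _ ≤ Real.exp (2 * Real.pi * m * (|z.im| + 1) ^ 2) * C * (2 * (p.1.im)⁻¹) :=
        mul_le_mul (mul_le_mul_of_nonneg_right h1 hC0) h2 (by positivity) (by positivity)
    _ = K * (p.1.im)⁻¹ := by rw [hK]; ring

lemma EisJ_add_int (hτ : 0 < τ.im) (n : ℤ) : EisJ k m (τ + n) z = EisJ k m τ z := by
  have hper : ∀ t : ℂ, 0 < t.im → ∀ l : ℕ, EisJ k m (t + l) z = EisJ k m t z := by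
    intro t ht l
    induction l with
    | zero => simp
    | succ l ih =>
      have : 0 < (t + l).im := by simpa using ht
      rw [Nat.cast_succ, ← add_assoc, EisJ_add_one this, ih]
  obtain ⟨l, rfl | rfl⟩ := n.eq_nat_or_neg
  · simpa using hper τ hτ l
  · have h := hper (τ - l) (by simpa using hτ) l
    rw [sub_add_cancel] at h
    rw [h]
    push_cast
    rw [sub_eq_add_neg]

lemma tsum_coprime_indicator : ∑' p : {p : ℤ × ℤ // IsCoprime p.1 p.2},
    (if p.1.1 = 0 then 1 else 0 : ℂ) = 2 := by
  have h1 : IsCoprime (0 : ℤ) 1 := isCoprime_one_right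
  have h2 : IsCoprime (0 : ℤ) (-1) := isCoprime_one_right.neg_right
  rw [tsum_eq_sum (s := {⟨(0, 1), h1⟩, ⟨(0, -1), h2⟩})]
  · rw [Finset.sum_pair (by simp)]
    norm_num
  · rintro ⟨⟨c, d⟩, hcd⟩ hp
    refine if_neg fun hc => hp ?_
    simp only at hc
    subst hc
    have hd : d = 1 ∨ d = -1 := Int.isUnit_iff.1 (isCoprime_zero_left.1 hcd)
    rcases hd with rfl | rfl <;> simp

lemma tendsto_EisJ (hm : 1 ≤ m) (hk : 5 ≤ k) (hk2 : Even k) (z : ℂ) :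
    Tendsto (fun p : ℂ × ℂ => EisJ k m p.1 p.2) (imInf ×ˢ 𝓝 z) (𝓝 1) := by
  set S : Set ℂ := {t | |t.re| ≤ 1}
  have hle : (imInf ⊓ 𝓟 S) ×ˢ 𝓝 z ≤ imInf ×ˢ 𝓝 z := Filter.prod_mono inf_le_left le_rfl
  obtain ⟨u, hu, hb⟩ := exists_summable_bound hk hm 1 1 (|z.im| + 1) one_pos
  have hz : ∀ᶠ w in 𝓝 z, |w.im| < |z.im| + 1 :=
    (isOpen_lt continuous_im.abs continuous_const).mem_nhds (lt_add_one |z.im|)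
  have hstrip : Tendsto (fun p : ℂ × ℂ => EisJ k m p.1 p.2) ((imInf ⊓ 𝓟 S) ×ˢ 𝓝 z) (𝓝 1) := by
    have key := tendsto_tsum_of_dominated_convergence (𝓕 := (imInf ⊓ 𝓟 S) ×ˢ 𝓝 z)
      (f := fun (x : ℂ × ℂ) (p : {p : ℤ × ℤ // IsCoprime p.1 p.2}) =>
        EisJSummand k m x.1 x.2 p.1.1 p.1.2)
      (g := fun p => (if p.1.1 = 0 then 1 else 0 : ℂ)) hu ?_ ?_
    · rw [tsum_coprime_indicator] at key
      have h2 := key.const_mul (1 / 2 : ℂ)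
      norm_num at h2
      simpa only [EisJ, one_div] using h2
    · rintro ⟨⟨c, d⟩, hcd⟩
      refine Tendsto.mono_left ?_ hle
      by_cases hc : c = 0
      · subst hc
        simpa using tendsto_EisJSummand_zero hm hk2 hcd z
      · simpa [hc] using tendsto_EisJSummand_of_ne_zero hm hk hcd hc z
    · have hS : ∀ᶠ t in imInf ⊓ 𝓟 S, t ∈ S := mem_inf_of_right (mem_principal_self S)
      filter_upwards [tendsto_fst.eventually hS,
        tendsto_fst.eventually ((eventually_imInf_gt 1).filter_mono inf_le_left),
        tendsto_snd.eventually hz] with x hx1 hx2 hx3 p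
      exact hb p _ _ hx1 hx2.le hx3.le
  have hshift : Tendsto (fun t : ℂ => t - (⌊t.re⌋ : ℤ)) imInf (imInf ⊓ 𝓟 S) := by
    refine tendsto_inf.2 ⟨?_, tendsto_principal.2 (Eventually.of_forall fun t => ?_)⟩
    · rw [imInf, tendsto_comap_iff]
      refine tendsto_comap.congr fun t => ?_
      simp
    · simp only [S, Set.mem_ofPred_eq, sub_re, intCast_re]
      rw [Int.self_sub_floor, abs_of_nonneg (Int.fract_nonneg _)]
      exact (Int.fract_lt_one _).le
  refine (hstrip.comp (hshift.prodMap tendsto_id)).congr' ?_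
  filter_upwards [tendsto_fst.eventually (eventually_imInf_gt 0)] with p hp
  have := EisJ_add_int (k := k) (m := m) (z := p.2) hp (-⌊p.1.re⌋)
  push_cast at this
  rw [← sub_eq_add_neg] at this
  exact this

lemma jacobiLike_EisJ (hk : 5 ≤ k) (hk2 : Even k) (hm : 1 ≤ m) :
    JacobiLike k m (EisJ k m) fun _ => 1 where
  continuousAt _ z hτ := continuousAt_EisJ hk hm hτ z
  differentiableAt_fst _ z hτ := differentiableAt_EisJ_fst hk hm hτ z
  differentiableAt_snd _ z hτ := differentiableAt_EisJ_snd hk hm hτ z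
  add_one _ _ hτ := EisJ_add_one hτ
  inv _ _ hτ := by simpa using EisJ_inv hτ
  add_one_right _ _ hτ := EisJ_add_one_right hτ
  add_tau_right _ _ hτ := by simpa using EisJ_add_tau_right hτ
  tendsto z := tendsto_EisJ hm hk hk2 z

end JacobiEisenstein

section WeightSix

open Filter Metric
open scoped Topology

local notation "π" => (Real.pi : ℂ)

/-- A Jacobi-like function of weight six and index two that vanishes at `i∞` is zero. -/
lemma JacobiLike.eq_zero {φ : ℂ → ℂ → ℂ} {g : ℂ → ℂ} (hφ : JacobiLike 6 2 φ g)
    (hg : ∀ z, g z = 0) {τ : ℂ} (hτ : 0 < τ.im) (z : ℂ) : φ τ z = 0 := by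
  obtain ⟨G, hG, hφG⟩ := hφ.exists_eq_pow_mul hg 6 (by norm_num)
  refine eq_zero_of_quasiperiodic hτ (f := φ τ) (θ := fun z => theta τ z ^ 4) (a := fun _ => 1)
    (b := fun z => e2 (-2 * (τ + 2 * z))) (fun z => hφ.differentiableAt_snd τ z hτ)
    ((differentiable_theta hτ).pow 4) (fun _ => one_ne_zero) (fun _ => e2_ne_zero _)
    (fun z => by rw [hφ.add_one_right τ z hτ, one_mul]) (fun z => ?_)
    (fun z => by rw [hφ.add_tau_right τ z hτ]; push_cast; rfl) (fun z => ?_)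
    (fun z hz => exists_of_theta_eq_zero hτ (pow_eq_zero_iff four_ne_zero |>.1 hz))
    (by simp [theta_zero]) ?_ ?_ z
  · rw [theta_add_one hτ]
    ring
  · rw [theta_add_tau hτ, mul_pow, neg_pow, ← Complex.exp_nat_mul, e2]
    norm_num
    left
    congr 1
    ring
  · exact (eventually_theta_ne_zero hτ).mono fun z hz => pow_ne_zero 4 hz
  · have h1 := ((tendsto_theta_div hτ).inv₀ (theta_deriv_ne_zero hτ)).pow 4
    have h2 : Tendsto (fun z : ℂ => z ^ 2 * G τ z) (𝓝[≠] 0) (𝓝 (0 ^ 2 * G τ 0)) :=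
      ((continuous_pow 2).mul (hG.differentiable τ hτ).continuous).continuousAt.tendsto.mono_left
        nhdsWithin_le_nhds
    have h3 := h2.mul h1
    rw [zero_pow two_ne_zero, zero_mul, zero_mul] at h3
    refine h3.congr fun w => ?_
    rw [hφG τ w hτ, inv_div, div_pow, mul_div_assoc', mul_right_comm, ← pow_add, mul_comm (w ^ _)]

lemma cosTerm_two_mul (z : ℂ) : cosTerm (2 * z) = 2 * cosTerm z ^ 2 - 1 := by
  have h1 : Complex.exp (π * I * (2 * z)) = Complex.exp (π * I * z) ^ 2 := by
    rw [← Complex.exp_nat_mul]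
    congr 1
    push_cast
    ring
  simp only [cosTerm, Complex.exp_neg, h1]
  have := Complex.exp_ne_zero (π * I * z)
  field_simp
  ring

lemma sinTerm_sq (z : ℂ) : sinTerm z ^ 2 = 4 * cosTerm z ^ 2 - 4 := by
  simp only [sinTerm, cosTerm, Complex.exp_neg]
  have := Complex.exp_ne_zero (π * I * z)
  field_simp
  ring

lemma six_EisJ_eq_phi02 {τ : ℂ} (hτ : 0 < τ.im) (z : ℂ) :
    6 * EisJ 6 2 τ z = EisJ 6 1 τ z * phi01 τ z - Eis 6 τ * phi02 τ z := by
  have hE1 : JacobiLike (6 : ℕ) (1 : ℕ) _ _ :=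
    jacobiLike_EisJ (by norm_num) (by decide) (by norm_num)
  have hE2 : JacobiLike (6 : ℕ) (2 : ℕ) _ _ :=
    jacobiLike_EisJ (by norm_num) (by decide) (by norm_num)
  have hE6 : JacobiLike (6 : ℕ) 0 _ _ := jacobiLike_Eis (by norm_num) (by decide)
  have hF := ((hE2.const_mul 6).add ((hE1.mul jacobiLike_phi01).const_mul (-1))).add
    (hE6.mul jacobiLike_phi02)
  have h0 := JacobiLike.eq_zero hF (fun z => by rw [cosTerm_two_mul]; ring) hτ z
  linear_combination h0

lemma six_EisJ_eq_phiM21 {τ : ℂ} (hτ : 0 < τ.im) (z : ℂ) :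
    6 * EisJ 6 2 τ z = (1 / 24) * (Eis 6 τ * phi01 τ z ^ 2 -
      2 * Eis 4 τ ^ 2 * phi01 τ z * phiM21 τ z + Eis 4 τ * Eis 6 τ * phiM21 τ z ^ 2) := by
  have hE2 : JacobiLike (6 : ℕ) (2 : ℕ) _ _ :=
    jacobiLike_EisJ (by norm_num) (by decide) (by norm_num)
  have hE4 : JacobiLike (4 : ℕ) 0 _ _ := jacobiLike_Eis (by norm_num) (by decide)
  have hE6 : JacobiLike (6 : ℕ) 0 _ _ := jacobiLike_Eis (by norm_num) (by decide)
  have h01 := jacobiLike_phi01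
  have h21 := jacobiLike_phiM21
  have hF := (((hE2.const_mul 6).add ((hE6.mul (h01.mul h01)).const_mul (-1 / 24))).add
    (((hE4.mul hE4).mul (h01.mul h21)).const_mul (1 / 12))).add
    (((hE4.mul hE6).mul (h21.mul h21)).const_mul (-1 / 24))
  have h0 := JacobiLike.eq_zero hF (fun z => by rw [sinTerm_sq]; ring) hτ z
  linear_combination h0

end WeightSix

/-- `6 E_{6,2} = E_{6,1} φ_{0,1} - E₆ φ_{0,2}
= (1/24)(E₆ φ_{0,1}² - 2 E₄² φ_{0,1} φ_{-2,1} + E₄ E₆ φ_{-2,1}²)` on `ℍ × ℂ`. -/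
theorem six_E62 (τ z : ℂ) (hτ : 0 < τ.im) :
    6 * EisJ 6 2 τ z = EisJ 6 1 τ z * phi01 τ z - Eis 6 τ * phi02 τ z ∧
    6 * EisJ 6 2 τ z = (1 / 24) * (Eis 6 τ * phi01 τ z ^ 2 -
      2 * Eis 4 τ ^ 2 * phi01 τ z * phiM21 τ z + Eis 4 τ * Eis 6 τ * phiM21 τ z ^ 2) := by
  exact ⟨six_EisJ_eq_phi02 hτ z, six_EisJ_eq_phiM21 hτ z⟩

end JacobiPaper
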